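/- arXiv:1807.02664 — 2 statements merged into one kernel-verified Lean document; each statement's English description precedes it below -/
import Mathlib

section
/- Let X be a compact, purely n-unrectifiable metric space with H^n(X) < ∞, and suppose that for H^n-almost every x in X one has liminf_{r→0} H^n(B(x,r))/r^n > 0. Then no continuous map g : X → [0,1]^n has a stable value. -/
open MeasureTheory Metric Set Filter
open scoped ENNReal NNReal Topology

/-- The unit cube `[0,1]^n` in Euclidean space. -/
def unitCube (n : ℕ) : Set (EuclideanSpace ℝ (Fin n)) :=
  {x | ∀ i, x i ∈ Set.Icc (0 : ℝ) 1}

/-- The supremum distance between two maps into Euclidean space. -/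
noncomputable def supDist {X : Type*} {n : ℕ} (f g : X → EuclideanSpace ℝ (Fin n)) : ℝ :=
  ⨆ x, dist (f x) (g x)

/-- `ε` is a stability parameter of `y` for the map `f : X → [0,1]^n`: every continuous
`g : X → [0,1]^n` at sup-distance less than `ε` from `f` attains the value `y`. -/
def IsStabilityParam {X : Type*} [MetricSpace X] {n : ℕ}
    (f : X → EuclideanSpace ℝ (Fin n)) (y : EuclideanSpace ℝ (Fin n)) (ε : ℝ) : Prop :=
  ∀ g : X → EuclideanSpace ℝ (Fin n), Continuous g → (∀ x, g x ∈ unitCube n) →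
    supDist g f < ε → y ∈ Set.range g

/-- `y` is a stable value of `f : X → [0,1]^n` if it has a positive stability parameter. -/
def IsStableValue {X : Type*} [MetricSpace X] {n : ℕ}
    (f : X → EuclideanSpace ℝ (Fin n)) (y : EuclideanSpace ℝ (Fin n)) : Prop :=
  ∃ ε > 0, IsStabilityParam f y ε

/-- An `H^n`-measurable set `E` in a metric space `X` is `n`-rectifiable if there are
measurable sets `F i ⊆ ℝ^n` and Lipschitz maps `f i : F i → X` such that
`H^n (E \ ⋃ i, f i '' F i) = 0`. -/
def IsRectifiableSet (n : ℕ) {X : Type*} [MetricSpace X] [MeasurableSpace X] [BorelSpace X]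
    (E : Set X) : Prop :=
  MeasurableSet E ∧
  ∃ (F : ℕ → Set (EuclideanSpace ℝ (Fin n))) (f : ℕ → EuclideanSpace ℝ (Fin n) → X),
    (∀ i, MeasurableSet (F i)) ∧ (∀ i, ∃ K : ℝ≥0, LipschitzOnWith K (f i) (F i)) ∧
    μH[n] (E \ ⋃ i, f i '' F i) = 0

/-- The value `z` cannot be removed from the image of the open ball `ball p c` by a continuous
modification of `f` supported in that ball. -/
def IsEssentialOn {X E : Type*} [PseudoMetricSpace X] [TopologicalSpace E]
    (f : X → E) (p : X) (c : ℝ) (z : E) : Prop :=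
  ∀ g : X → E, Continuous g → (∀ x, c ≤ dist x p → g x = f x) → ∃ x, dist x p < c ∧ g x = z

section Essential

variable {X E : Type*} [MetricSpace X] [NormedAddCommGroup E] [NormedSpace ℝ E]
  {f : X → E} {p : X} {c : ℝ} {z z' : E}

theorem IsEssentialOn.of_dist_lt (hf : Continuous f) (h : IsEssentialOn f p c z) {δ : ℝ}
    (hδ : ∀ x, dist x p = c → δ ≤ dist (f x) z') (hz : dist z z' < δ) :
    IsEssentialOn f p c z' := by
  have hδ0 : 0 < δ := dist_nonneg.trans_lt hz
  intro g hg hgf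
  let ψ : E → E := fun w => w + (max 0 (1 - dist w z' / δ)) • (z - z')
  have hψ : Continuous ψ := by fun_prop
  have hψfar : ∀ w, δ ≤ dist w z' → ψ w = w := by
    intro w hw
    have : 1 - dist w z' / δ ≤ 0 := by
      rw [sub_nonpos, one_le_div hδ0]; exact hw
    simp [ψ, max_eq_left this]
  have hψz : ∀ w, ψ w = z → w = z' := by
    intro w hw
    by_contra hne
    have hpos : 0 < dist w z' := dist_pos.2 hne
    set φ := max 0 (1 - dist w z' / δ) with hφ
    have h1 : w - z' = (1 - φ) • (z - z') := by
      have : w + φ • (z - z') = z := hw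
      rw [sub_smul, one_smul, sub_right_comm, eq_sub_of_add_eq this]
    have h2 : 0 ≤ 1 - φ := by
      have : 0 ≤ dist w z' / δ := by positivity
      rw [sub_nonneg]; exact max_le zero_le_one (by linarith)
    have h3 : 1 - φ ≤ dist w z' / δ := by
      have := le_max_right 0 (1 - dist w z' / δ); linarith
    have h4 : dist w z' = (1 - φ) * dist z z' := by
      rw [dist_eq_norm, h1, norm_smul, Real.norm_of_nonneg h2, dist_eq_norm]
    have h5 : (1 - φ) * dist z z' ≤ dist w z' / δ * dist z z' := by gcongr
    have h6 : dist w z' / δ * dist z z' < dist w z' / δ * δ := by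
      have : 0 < dist w z' / δ := by positivity
      gcongr
    rw [div_mul_cancel₀ _ hδ0.ne'] at h6
    linarith
  have hcont : Continuous fun x => if dist x p ≤ c then ψ (g x) else f x := by
    refine Continuous.if_le (hψ.comp hg) hf (by fun_prop) continuous_const ?_
    intro x hx
    rw [hgf x hx.ge, hψfar _ (hδ x hx)]
  obtain ⟨x, hx, hxz⟩ := h _ hcont (by
    intro x hx
    by_cases hxc : dist x p ≤ c
    · have hxe := le_antisymm hxc hx
      simp only [hxc, if_true]
      rw [hgf x hx, hψfar _ (hδ x hxe)]
    · simp [hxc])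
  simp only [hx.le, if_true] at hxz
  exact ⟨x, hx, hψz _ hxz⟩

theorem isEssentialOn_iff_of_ball (hf : Continuous f) {δ : ℝ}
    (hδ : ∀ x, dist x p = c → δ ≤ dist (f x) z) (hz : dist z z' < δ / 2) :
    IsEssentialOn f p c z ↔ IsEssentialOn f p c z' := by
  constructor
  · intro h
    refine h.of_dist_lt hf (δ := δ / 2) (fun x hx => ?_) hz
    have := dist_triangle_right (f x) z z'
    have := hδ x hx
    linarith
  · intro h
    refine h.of_dist_lt hf hδ ?_
    rw [dist_comm]
    have : 0 ≤ dist z z' := dist_nonneg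
    linarith

variable [CompactSpace X]

omit [NormedSpace ℝ E] in
theorem exists_pos_le_dist_of_notMem (hf : Continuous f)
    (hz : ∀ x, dist x p = c → f x ≠ z) :
    ∃ δ > 0, ∀ x, dist x p = c → δ ≤ dist (f x) z := by
  have hcl : IsClosed (f '' {x | dist x p = c}) :=
    ((isClosed_eq (by fun_prop) continuous_const).isCompact.image hf).isClosed
  have hmem : (f '' {x | dist x p = c})ᶜ ∈ 𝓝 z := hcl.isOpen_compl.mem_nhds (by
    rintro ⟨x, hx, hxz⟩; exact hz x hx hxz)
  obtain ⟨δ, hδ, hsub⟩ := Metric.mem_nhds_iff.1 hmem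
  refine ⟨δ, hδ, fun x hx => ?_⟩
  by_contra! hlt
  exact hsub hlt ⟨x, hx, rfl⟩

theorem eventually_isEssentialOn_iff (hf : Continuous f)
    (hz : ∀ x, dist x p = c → f x ≠ z) :
    ∀ᶠ w in 𝓝 z, (IsEssentialOn f p c z ↔ IsEssentialOn f p c w) := by
  obtain ⟨δ, hδ, h⟩ := exists_pos_le_dist_of_notMem hf hz
  filter_upwards [Metric.ball_mem_nhds z (half_pos hδ)] with w hw
  exact isEssentialOn_iff_of_ball hf h (by rwa [dist_comm])

theorem isEssentialOn_iff_of_segment (hf : Continuous f)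
    (hz : ∀ x, dist x p = c → f x ∉ segment ℝ z z') :
    IsEssentialOn f p c z ↔ IsEssentialOn f p c z' := by
  refine (convex_segment z z').isPreconnected.induction₂
    (fun v w => IsEssentialOn f p c v ↔ IsEssentialOn f p c w) (fun w hw => ?_)
    (fun _ _ _ _ _ _ h h' => h.trans h') (fun _ _ _ _ h => h.symm)
    (left_mem_segment ℝ z z') (right_mem_segment ℝ z z')
  exact nhdsWithin_le_nhds
    (eventually_isEssentialOn_iff hf fun x hx hxw => hz x hx (hxw ▸ hw))

end Essential

theorem exists_pos_lt_dist_of_finite {X : Type*} [MetricSpace X] {s : Set X} (hs : s.Finite) :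
    ∃ δ > 0, ∀ x ∈ s, ∀ y ∈ s, x ≠ y → δ < dist x y := by
  obtain ⟨C, hC, h⟩ := Set.einfsep_pos.1 hs.einfsep_pos
  obtain ⟨δ, hδ, hδC⟩ := ENNReal.lt_iff_exists_nnreal_btwn.1 hC
  refine ⟨δ, by exact_mod_cast hδ, fun x hx y hy hxy => ?_⟩
  have := hδC.trans_le (h x hx y hy hxy)
  rw [edist_nndist] at this
  exact_mod_cast this

section Remove

variable {X E : Type*} [MetricSpace X] [NormedAddCommGroup E] [NormedSpace ℝ E] {f : X → E} {z : E}

omit [NormedSpace ℝ E] in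
theorem exists_forall_ne_of_forall_not_isEssentialOn (hf : Continuous f)
    (hfin : (f ⁻¹' {z}).Finite) (hz : ∀ x, f x = z → ∀ ρ > 0, ∃ c ∈ Ioo 0 ρ, ¬ IsEssentialOn f x c z)
    {ρ : ℝ} (hρ : 0 < ρ) :
    ∃ g : X → E, Continuous g ∧ (∀ x, g x ≠ z) ∧
      ∀ x, g x ≠ f x → ∃ t, f t = z ∧ dist x t < ρ := by
  obtain ⟨δ, hδ, hsep⟩ := exists_pos_lt_dist_of_finite hfin
  choose! c hc hess using fun x hx => hz x hx (min ρ (δ / 2)) (by positivity)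
  simp only [IsEssentialOn, not_forall, not_exists, not_and] at hess
  choose! G hG hGf hGz using hess
  have hdisj : ∀ t, f t = z → ∀ s, f s = z → ∀ x, dist x t < c t → dist x s < c s → s = t := by
    intro t ht s hs x hxt hxs
    by_contra hne
    have h1 := hsep s hs t ht hne
    have h2 := dist_triangle_left s t x
    have h3 := (hc t ht).2.trans_le (min_le_right _ _)
    have h4 := (hc s hs).2.trans_le (min_le_right _ _)
    linarith
  have hin : ∀ t, f t = z → ∀ x, dist x t < c t →
      f x + ∑ s ∈ hfin.toFinset, (G s x - f x) = G t x := by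
    intro t ht x hx
    rw [Finset.sum_eq_single t]
    · abel
    · intro s hs hst
      have hs : f s = z := by simpa using hs
      rw [hGf s hs x (not_lt.1 fun h => hst (hdisj t ht s hs x hx h)), sub_self]
    · intro h
      exact absurd (by simpa using ht) h
  have hout : ∀ x, (∀ t, f t = z → c t ≤ dist x t) →
      f x + ∑ s ∈ hfin.toFinset, (G s x - f x) = f x := by
    intro x hx
    rw [Finset.sum_eq_zero, add_zero]
    intro s hs
    have hs : f s = z := by simpa using hs
    rw [hGf s hs x (hx s hs), sub_self]
  refine ⟨fun x => f x + ∑ t ∈ hfin.toFinset, (G t x - f x), ?_, fun x hx => ?_, fun x hx => ?_⟩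
  · refine hf.add (continuous_finsetSum _ fun t ht => (hG t ?_).sub hf)
    simpa using ht
  · by_cases h : ∃ t, f t = z ∧ dist x t < c t
    · obtain ⟨t, ht, hxt⟩ := h
      exact hGz t ht x hxt ((hin t ht x hxt).symm.trans hx)
    · push Not at h
      have hfx : f x = z := (hout x h).symm.trans hx
      have := h x hfx
      rw [dist_self] at this
      exact absurd (hc x hfx).1 this.not_gt
  · by_contra! h
    exact hx (hout x fun t ht => ((hc t ht).2.le.trans (min_le_left _ _)).trans (h t ht))

theorem exists_forall_ne_and_dist_le [CompactSpace X] (hf : Continuous f)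
    (hfin : (f ⁻¹' {z}).Finite) (hz : ∀ x, f x = z → ∀ ρ > 0, ∃ c ∈ Ioo 0 ρ, ¬ IsEssentialOn f x c z)
    {ε : ℝ} (hε : 0 < ε) :
    ∃ g : X → E, Continuous g ∧ (∀ x, g x ≠ z) ∧ ∀ x, dist (g x) (f x) ≤ ε := by
  obtain ⟨ρ, hρ, hunif⟩ := Metric.uniformContinuous_iff.1
    (CompactSpace.uniformContinuous_of_continuous hf) (ε / 2) (by positivity)
  obtain ⟨g, hg, hgz, hgf⟩ := exists_forall_ne_of_forall_not_isEssentialOn hf hfin hz hρ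
  have hpos : ∀ x, 0 < ‖g x - z‖ := fun x => norm_pos_iff.2 (sub_ne_zero.2 (hgz x))
  have hR : ∀ x, 0 < max ‖f x - z‖ (ε / 2) := fun x => lt_max_of_lt_right (by positivity)
  refine ⟨fun x => z + (min 1 (max ‖f x - z‖ (ε / 2) / ‖g x - z‖)) • (g x - z), ?_, fun x => ?_,
    fun x => ?_⟩
  · have : Continuous fun x => max ‖f x - z‖ (ε / 2) / ‖g x - z‖ :=
      Continuous.div (by fun_prop) (by fun_prop) fun x => (hpos x).ne'
    fun_prop
  · have : 0 < min 1 (max ‖f x - z‖ (ε / 2) / ‖g x - z‖) :=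
      lt_min one_pos (div_pos (hR x) (hpos x))
    simpa [sub_eq_zero, this.ne'] using hgz x
  · by_cases h : g x = f x
    · have : 1 ≤ max ‖f x - z‖ (ε / 2) / ‖g x - z‖ := by
        rw [one_le_div (hpos x), h]; exact le_max_left _ _
      simp only [min_eq_left this]
      simp [h, hε.le]
    · obtain ⟨t, ht, hxt⟩ := hgf x h
      have h1 : ‖f x - z‖ < ε / 2 := by
        rw [← dist_eq_norm, ← ht]; exact hunif hxt
      have h2 : dist (z + (min 1 (max ‖f x - z‖ (ε / 2) / ‖g x - z‖)) • (g x - z)) z ≤ ε / 2 := by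
        rw [dist_eq_norm, add_sub_cancel_left, norm_smul,
          Real.norm_of_nonneg (le_min zero_le_one (div_pos (hR x) (hpos x)).le)]
        calc _ ≤ (max ‖f x - z‖ (ε / 2) / ‖g x - z‖) * ‖g x - z‖ := by
              gcongr; exact min_le_right _ _
          _ = max ‖f x - z‖ (ε / 2) := div_mul_cancel₀ _ (hpos x).ne'
          _ ≤ ε / 2 := max_le h1.le le_rfl
      have h3 := dist_triangle_right (z + (min 1 (max ‖f x - z‖ (ε / 2) / ‖g x - z‖)) • (g x - z))
        (f x) z
      rw [dist_eq_norm (f x)] at h3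
      linarith

end Remove

section FiniteFibers

variable {X E : Type*} [MetricSpace X] [SecondCountableTopology X] [MeasurableSpace X]
  [BorelSpace X]

theorem exists_measurable_partition_dist_le [Nonempty X] {ε : ℝ} (hε : 0 < ε) :
    ∃ P : ℕ → Set X, (∀ j, MeasurableSet (P j)) ∧ Pairwise (Function.onFun Disjoint P) ∧
      ⋃ j, P j = univ ∧ ∀ j, ∀ x ∈ P j, ∀ y ∈ P j, dist x y ≤ ε := by
  let u := TopologicalSpace.denseSeq X
  refine ⟨disjointed fun j => closedBall (u j) (ε / 2), fun j =>
    MeasurableSet.disjointed (fun _ => measurableSet_closedBall) j, disjoint_disjointed _, ?_, ?_⟩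
  · rw [iUnion_disjointed, eq_univ_iff_forall]
    intro x
    obtain ⟨j, hj⟩ := (TopologicalSpace.denseRange_denseSeq X).exists_dist_lt x (half_pos hε)
    exact mem_iUnion.2 ⟨j, hj.le⟩
  · intro j x hx y hy
    have h1 := disjointed_subset _ j hx
    have h2 := disjointed_subset _ j hy
    have := dist_triangle_right x y (u j)
    rw [mem_closedBall] at h1 h2
    linarith

/-- If `f` increases the measure of every set by a bounded factor, almost every fibre is finite. -/
theorem ae_finite_preimage_singleton [MeasurableSpace E] {μ : Measure X} [IsFiniteMeasure μ]
    {ν : Measure E} {f : X → E} {C : ℝ≥0∞} (hC : C ≠ ∞)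
    (hf : ∀ s, ν (f '' s) ≤ C * μ s) : ∀ᵐ z ∂ν, (f ⁻¹' {z}).Finite := by
  rcases isEmpty_or_nonempty X with hX | hX
  · exact Eventually.of_forall fun z => Set.toFinite _
  choose P hPm hPd hPu hPε using fun k : ℕ =>
    exists_measurable_partition_dist_le (X := X) (Nat.one_div_pos_of_nat (α := ℝ) (n := k))
  let A : ℕ → ℕ → Set E := fun k j => toMeasurable ν (f '' P k j)
  let N : ℕ → E → ℝ≥0∞ := fun k z => ∑' j, (A k j).indicator 1 z
  have hAm : ∀ k j, MeasurableSet (A k j) := fun k j => measurableSet_toMeasurable _ _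
  have hNm : ∀ k, Measurable (N k) := fun k =>
    Measurable.tsum fun j => measurable_one.indicator (hAm k j)
  have hNint : ∀ k, ∫⁻ z, N k z ∂ν ≤ C * μ univ := by
    intro k
    rw [lintegral_tsum fun j => (measurable_one.indicator (hAm k j)).aemeasurable, ← hPu k,
      measure_iUnion (hPd k) (hPm k), ← ENNReal.tsum_mul_left]
    refine ENNReal.tsum_le_tsum fun j => ?_
    rw [lintegral_indicator_one (hAm k j), measure_toMeasurable]
    exact hf _
  have hlim : ∫⁻ z, liminf (fun k => N k z) atTop ∂ν ≠ ∞ := by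
    refine ((lintegral_liminf_le hNm).trans ?_).trans_lt
      (ENNReal.mul_lt_top hC.lt_top (measure_lt_top μ univ)) |>.ne
    exact liminf_le_of_le (by isBoundedDefault) fun b hb => by
      obtain ⟨k, hk⟩ := hb.exists
      exact hk.trans (hNint k)
  filter_upwards [ae_lt_top (Measurable.liminf hNm) hlim] with z hz
  by_contra hinf
  refine hz.ne (ENNReal.eq_top_of_forall_nnreal_le fun r => ?_)
  obtain ⟨m, hm⟩ := exists_nat_ge r
  refine le_trans (by exact_mod_cast hm : (r : ℝ≥0∞) ≤ (m : ℝ≥0∞)) ?_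
  obtain ⟨T, hTsub, hTcard⟩ := Set.Infinite.exists_subset_card_eq hinf m
  obtain ⟨δ, hδ, hsep⟩ := exists_pos_lt_dist_of_finite T.finite_toSet
  obtain ⟨k₀, hk₀⟩ := exists_nat_one_div_lt hδ
  refine le_liminf_of_le (by isBoundedDefault) ?_
  filter_upwards [eventually_ge_atTop k₀] with k hk
  have hex : ∀ x, ∃ j, x ∈ P k j := fun x => mem_iUnion.1 (hPu k ▸ mem_univ x)
  choose J hJ using hex
  have hinj : Set.InjOn J T := by
    intro x hx y hy hxy
    by_contra hne
    have h1 := hsep x hx y hy hne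
    have h2 := hPε k (J x) x (hJ x) y (hxy ▸ hJ y)
    have h3 : (1 : ℝ) / (k + 1) ≤ 1 / (k₀ + 1) := by gcongr
    linarith
  calc (m : ℝ≥0∞) = ∑ j ∈ T.image J, (A k j).indicator 1 z := by
        rw [Finset.sum_image hinj, Finset.sum_congr rfl (g := fun _ => 1), Finset.sum_const, hTcard,
          nsmul_one]
        intro x hx
        have : z ∈ A k (J x) := subset_toMeasurable _ _ ⟨x, hJ x, hTsub hx⟩
        simp [this]
    _ ≤ N k z := ENNReal.sum_le_tsum _

end FiniteFibers

section Density

/-- A finite measure has finite upper density at almost every point of `ℝ^n`. -/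
theorem ae_exists_measure_closedBall_le {n : ℕ} (ν : Measure (Fin n → ℝ)) [IsFiniteMeasure ν] :
    ∀ᵐ z : Fin n → ℝ, ∃ m : ℕ, ∀ r, 0 < r → r < 1 / (m + 1 : ℝ) →
      ν (closedBall z r) ≤ ENNReal.ofReal (m * r ^ n) := by
  filter_upwards [Besicovitch.ae_tendsto_rnDeriv ν volume, ν.rnDeriv_lt_top volume] with z hz hlt
  obtain ⟨M, hM, -⟩ := ENNReal.lt_iff_exists_nnreal_btwn.1 hlt
  have h1 := hz.eventually (gt_mem_nhds hM)
  obtain ⟨δ, hδ, hsub⟩ := mem_nhdsGT_iff_exists_Ioo_subset.1 h1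
  obtain ⟨m₁, hm₁⟩ := exists_nat_one_div_lt (show (0 : ℝ) < δ from hδ)
  obtain ⟨m₂, hm₂⟩ := exists_nat_ge (M * 2 ^ n : ℝ)
  refine ⟨max m₁ m₂, fun r hr hrm => ?_⟩
  have hrδ : r < δ := by
    refine (hrm.trans_le ?_).trans hm₁
    gcongr
    exact le_max_left _ _
  have h2 : ν (closedBall z r) / volume (closedBall z r) < M := hsub ⟨hr, hrδ⟩
  rw [Real.volume_pi_closedBall z hr.le, Fintype.card_fin] at h2
  have h3 : 0 < (2 * r) ^ n := by positivity
  rw [ENNReal.div_lt_iff (Or.inl (by simpa using h3)) (Or.inl ENNReal.ofReal_ne_top)] at h2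
  refine h2.le.trans ?_
  rw [← ENNReal.ofReal_coe_nnreal, ← ENNReal.ofReal_mul (by positivity), mul_pow, ← mul_assoc]
  refine ENNReal.ofReal_le_ofReal ?_
  gcongr
  exact hm₂.trans (by exact_mod_cast le_max_right _ _)

end Density

section Staircase

variable {n : ℕ}

theorem measurable_volume_update {P : Set (Fin n → ℝ)} (hP : MeasurableSet P) (i : Fin n) :
    Measurable fun w : Fin n → ℝ => volume {c : ℝ | Function.update w i c ∈ P} := by
  have h : (fun w : Fin n → ℝ => volume {c : ℝ | Function.update w i c ∈ P}) =
      ∫⋯∫⁻_{i}, P.indicator 1 ∂(fun _ => volume) := by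
    rw [lmarginal_singleton]
    funext w
    exact (lintegral_indicator_one (measurable_update w hP)).symm
  rw [h]
  exact Measurable.lmarginal _ (measurable_one.indicator hP)

theorem setLIntegral_closedBall_volume_update_le {P : Set (Fin n → ℝ)} (hP : MeasurableSet P)
    (i : Fin n) (z : Fin n → ℝ) {r : ℝ} (hr : 0 ≤ r) :
    ∫⁻ w in closedBall z r, volume {c : ℝ | Function.update w i c ∈ P} ≤
      ENNReal.ofReal (2 * r) * volume P := by
  have hm := measurable_volume_update hP i
  have hmP : Measurable (P.indicator (1 : (Fin n → ℝ) → ℝ≥0∞)) := measurable_one.indicator hP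
  rw [← lintegral_indicator measurableSet_closedBall, ← lintegral_indicator_one hP,
    ← lintegral_const_mul _ hmP]
  refine lintegral_le_of_lmarginal_le {i} (hm.indicator measurableSet_closedBall)
    (hmP.const_mul _) fun w => ?_
  rw [lmarginal_singleton, lmarginal_singleton]
  have h1 : ∫⁻ t, ENNReal.ofReal (2 * r) * P.indicator 1 (Function.update w i t) =
      ENNReal.ofReal (2 * r) * volume {c : ℝ | Function.update w i c ∈ P} := by
    refine (lintegral_const_mul _ (hmP.comp (measurable_update w))).trans ?_
    congr 1
    exact lintegral_indicator_one (measurable_update w hP)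
  beta_reduce
  rw [h1, ← Real.volume_closedBall (z i) r, mul_comm, ← setLIntegral_const,
    ← lintegral_indicator measurableSet_closedBall]
  refine lintegral_mono fun t => ?_
  by_cases ht : Function.update w i t ∈ closedBall z r
  · have ht' : t ∈ closedBall (z i) r := by
      have := (dist_pi_le_iff hr).1 (mem_closedBall.1 ht) i
      simpa using this
    simp [indicator_of_mem ht, indicator_of_mem ht']
  · simp [indicator_of_notMem ht]

theorem lintegral_comp_diagonal {G : (Fin n → ℝ) → ℝ≥0∞} (hG : Measurable G) (z : Fin n → ℝ)
    {D : Fin n → ℝ} (hD : ∀ j, 0 < D j) :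
    ENNReal.ofReal (∏ j, D j) * ∫⁻ w : Fin n → ℝ, G (fun j => z j + D j * (w j - z j)) = ∫⁻ w, G w := by
  have hdet : (Matrix.diagonal D).det = ∏ j, D j := Matrix.det_diagonal
  have hpos : 0 < ∏ j, D j := Finset.prod_pos fun j _ => hD j
  have h1 : ∫⁻ w : Fin n → ℝ, G (fun j => z j + D j * (w j - z j)) = ∫⁻ u : Fin n → ℝ, G (fun j => z j + D j * u j) :=
    lintegral_sub_right_eq_self (fun u : Fin n → ℝ => G (fun j => z j + D j * u j)) z
  have h2 : ∫⁻ w, G w = ∫⁻ u, G (z + u) := (lintegral_add_left_eq_self G z).symm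
  have hG' : Measurable fun u => G (z + u) := hG.comp (measurable_const_add z)
  rw [h1, h2]
  nth_rewrite 2 [← Real.smul_map_diagonal_volume_pi (D := D) (by rw [hdet]; exact hpos.ne')]
  rw [lintegral_smul_measure, hdet, abs_of_pos hpos, smul_eq_mul,
    lintegral_map hG' (LinearMap.continuous_on_pi _).measurable]
  congr 1
  refine lintegral_congr fun u => ?_
  congr 1
  funext j
  simp [Matrix.mulVec_diagonal]

theorem setLIntegral_volume_update_diagonal_le {P : Set (Fin n → ℝ)} (hP : MeasurableSet P)
    (i : Fin n) (z : Fin n → ℝ) {r s a : ℝ} (hr : 0 ≤ r) (ha : 0 < a) {D : Fin n → ℝ}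
    (hDa : ∀ j, a ≤ D j) (hDs : ∀ j, D j ≤ s) (hs : 0 ≤ s) :
    ∫⁻ w : Fin n → ℝ in closedBall z r,
        volume {c : ℝ | Function.update (fun j => z j + D j * (w j - z j)) i c ∈ P} ≤
      ENNReal.ofReal ((a ^ n)⁻¹ * (2 * (s * r))) * volume P := by
  have hD : ∀ j, 0 < D j := fun j => ha.trans_le (hDa j)
  let G : (Fin n → ℝ) → ℝ≥0∞ := (closedBall z (s * r)).indicator
    fun w => volume {c : ℝ | Function.update w i c ∈ P}
  have hG : Measurable G := (measurable_volume_update hP i).indicator measurableSet_closedBall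
  have hGint : ∫⁻ w, G w ≤ ENNReal.ofReal (2 * (s * r)) * volume P := by
    rw [lintegral_indicator measurableSet_closedBall]
    exact setLIntegral_closedBall_volume_update_le hP i z (by positivity)
  have hprod : a ^ n ≤ ∏ j, D j := by
    calc a ^ n = ∏ _j : Fin n, a := by simp
      _ ≤ _ := Finset.prod_le_prod (fun _ _ => ha.le) fun j _ => hDa j
  have han : 0 < a ^ n := by positivity
  calc _ ≤ ∫⁻ w : Fin n → ℝ, G (fun j => z j + D j * (w j - z j)) := by
        rw [← lintegral_indicator measurableSet_closedBall]
        refine lintegral_mono fun w => ?_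
        by_cases hw : w ∈ closedBall z r
        · have hw' : (fun j => z j + D j * (w j - z j)) ∈ closedBall z (s * r) := by
            rw [mem_closedBall, dist_pi_le_iff (by positivity)]
            intro j
            have h1 := (dist_pi_le_iff hr).1 (mem_closedBall.1 hw) j
            rw [Real.dist_eq] at h1 ⊢
            rw [add_sub_cancel_left, abs_mul, abs_of_pos (hD j)]
            exact mul_le_mul (hDs j) h1 (abs_nonneg _) hs
          simp only [G, indicator_of_mem hw, indicator_of_mem hw', le_refl]
        · simp only [indicator_of_notMem hw, zero_le]
    _ ≤ (ENNReal.ofReal (a ^ n))⁻¹ * (ENNReal.ofReal (a ^ n) *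
          ∫⁻ w : Fin n → ℝ, G (fun j => z j + D j * (w j - z j))) := by
        rw [← mul_assoc, ENNReal.inv_mul_cancel (by simpa using han) ENNReal.ofReal_ne_top, one_mul]
    _ ≤ (ENNReal.ofReal (a ^ n))⁻¹ * (ENNReal.ofReal (2 * (s * r)) * volume P) := by
        refine mul_le_mul_right ?_ _
        refine le_trans ?_ ((lintegral_comp_diagonal hG z hD).le.trans hGint)
        gcongr
    _ = _ := by
        rw [ENNReal.ofReal_mul (inv_nonneg.2 han.le), ENNReal.ofReal_inv_of_pos han, mul_assoc]

end Staircase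

section Blocking

variable {n : ℕ}

/-- Corner points of a coordinatewise staircase from `w` to `z` that halves the distance to `z`
in every coordinate at each stage `k`; `i` coordinates have already been halved at stage `k`. -/
noncomputable def staircase (z w : Fin n → ℝ) (k i : ℕ) : Fin n → ℝ := fun j =>
  z j + (if j.val < i then (1 / 2 : ℝ) ^ (k + 1) else (1 / 2) ^ k) * (w j - z j)

theorem staircase_zero_zero (z w : Fin n → ℝ) : staircase z w 0 0 = w := by
  funext j; simp [staircase]

theorem staircase_dim (z w : Fin n → ℝ) (k : ℕ) : staircase z w k n = staircase z w (k + 1) 0 := by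
  funext j; simp [staircase, j.2]

theorem tendsto_staircase (z w : Fin n → ℝ) :
    Tendsto (fun k => staircase z w k 0) atTop (𝓝 z) := by
  rw [tendsto_pi_nhds]
  intro j
  have h := (tendsto_pow_atTop_nhds_zero_of_lt_one (r := (1 / 2 : ℝ)) (by norm_num)
    (by norm_num)).mul_const (w j - z j) |>.const_add (z j)
  simpa [staircase] using h

theorem staircase_mem_closedBall {z w : Fin n → ℝ} {r : ℝ} (hr : 0 ≤ r) (hw : w ∈ closedBall z r)
    (k i : ℕ) : staircase z w k i ∈ closedBall z ((1 / 2) ^ k * r) := by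
  rw [mem_closedBall, dist_pi_le_iff (by positivity)]
  intro j
  have h1 := (dist_pi_le_iff hr).1 (mem_closedBall.1 hw) j
  rw [Real.dist_eq] at h1 ⊢
  have h2 : (if j.val < i then (1 / 2 : ℝ) ^ (k + 1) else (1 / 2) ^ k) ≤ (1 / 2) ^ k := by
    split_ifs
    · exact pow_le_pow_of_le_one (by norm_num) (by norm_num) (Nat.le_succ k)
    · exact le_rfl
  have h3 : 0 ≤ (if j.val < i then (1 / 2 : ℝ) ^ (k + 1) else (1 / 2) ^ k) := by positivity
  rw [staircase, add_sub_cancel_left, abs_mul, abs_of_nonneg h3]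
  gcongr

theorem eq_of_mem_segment_staircase {z w v : Fin n → ℝ} {k : ℕ} {i : Fin n}
    (hv : v ∈ segment ℝ (staircase z w k i) (staircase z w k (i + 1))) {j : Fin n} (hj : j ≠ i) :
    v j = staircase z w k i j := by
  obtain ⟨a, b, -, -, hab, rfl⟩ := hv
  have h : staircase z w k (i + 1) j = staircase z w k i j := by
    have : (j : ℕ) < i + 1 ↔ (j : ℕ) < i := by
      have : (j : ℕ) ≠ i := fun h => hj (Fin.ext h)
      omega
    simp only [staircase, this]
  simp only [Pi.add_apply, Pi.smul_apply, smul_eq_mul, h]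
  rw [← add_mul, hab, one_mul]

variable {X : Type*} [MetricSpace X] [CompactSpace X] {f : X → Fin n → ℝ} {p : X}

/-- The points of `ℝ^n` obtained from `f q`, with `f q` in a given set, by replacing the `i`-th
coordinate with the distance from `q` to `p`. -/
def distReplaced (f : X → Fin n → ℝ) (p : X) (i : Fin n) (Q : Set (Fin n → ℝ)) :
    Set (Fin n → ℝ) :=
  (fun q => Function.update (f q) i (dist q p)) '' (f ⁻¹' Q)

theorem isEssentialOn_iff_of_staircase (hf : Continuous f) {z w : Fin n → ℝ} {r c : ℝ}
    (hr : 0 ≤ r) (hw : w ∈ closedBall z r) (hz : ∀ q, dist q p = c → f q ≠ z)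
    (hc : ∀ (k : ℕ) (i : Fin n), Function.update (staircase z w k i) i c ∉
      distReplaced f p i (closedBall z ((1 / 2) ^ k * r))) :
    IsEssentialOn f p c z ↔ IsEssentialOn f p c w := by
  have hstep : ∀ k (i : Fin n), IsEssentialOn f p c (staircase z w k i) ↔
      IsEssentialOn f p c (staircase z w k (i + 1)) := by
    intro k i
    refine isEssentialOn_iff_of_segment hf fun q hq hseg => hc k i ⟨q, ?_, ?_⟩
    · exact (convex_closedBall z _).segment_subset (staircase_mem_closedBall hr hw k _)
        (staircase_mem_closedBall hr hw k _) hseg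
    · funext j
      by_cases hj : j = i
      · subst hj; simp [hq]
      · simp [hj, eq_of_mem_segment_staircase hseg hj]
  have hstage : ∀ k i : ℕ, i ≤ n → (IsEssentialOn f p c (staircase z w k 0) ↔
      IsEssentialOn f p c (staircase z w k i)) := by
    intro k i
    induction i with
    | zero => simp
    | succ i ih => exact fun hi => (ih (by omega)).trans (hstep k ⟨i, hi⟩)
  have hall : ∀ k, IsEssentialOn f p c w ↔ IsEssentialOn f p c (staircase z w k 0) := by
    intro k
    induction k with
    | zero => rw [staircase_zero_zero]
    | succ k ih => rw [ih, ← staircase_dim]; exact hstage k n le_rfl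
  obtain ⟨k, hk⟩ := ((tendsto_staircase z w).eventually
    (eventually_isEssentialOn_iff hf hz)).exists
  exact hk.trans (hall k).symm

theorem isCompact_distReplaced (hf : Continuous f) (p : X) (i : Fin n) {Q : Set (Fin n → ℝ)}
    (hQ : IsClosed Q) : IsCompact (distReplaced f p i Q) :=
  (hQ.preimage hf).isCompact.image (by fun_prop)

variable [MeasurableSpace X] [BorelSpace X]

omit [CompactSpace X] in
theorem volume_distReplaced_le {L : ℝ≥0} (hf : LipschitzWith L f) (hL : 1 ≤ L) (p : X) (i : Fin n)
    (Q : Set (Fin n → ℝ)) :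
    volume (distReplaced f p i Q) ≤ (L : ℝ≥0∞) ^ n * μH[n] (f ⁻¹' Q) := by
  have h : LipschitzWith L fun q => Function.update (f q) i (dist q p) := by
    refine LipschitzWith.of_dist_le_mul fun q q' => ?_
    rw [dist_pi_le_iff (by positivity)]
    intro j
    by_cases hj : j = i
    · subst hj
      rw [Function.update_self, Function.update_self, Real.dist_eq]
      refine (abs_dist_sub_le q q' p).trans ?_
      exact le_mul_of_one_le_left dist_nonneg (by exact_mod_cast hL)
    · rw [Function.update_of_ne hj, Function.update_of_ne hj]
      exact (dist_le_pi_dist _ _ j).trans (hf.dist_le_mul q q')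
  have := h.hausdorffMeasure_image_le (d := n) (Nat.cast_nonneg n) (f ⁻¹' Q)
  rw [ENNReal.rpow_natCast] at this
  refine le_trans (le_of_eq ?_) this
  rw [← hausdorffMeasure_pi_real, Fintype.card_fin]
  rfl

/-- Up to a set of radii of measure `S w`, the points `z` and `w` are essential on the same balls
centred at `p`, where the average of `S` over a ball of radius `r` is at most a multiple of `r`. -/
theorem exists_lintegral_le_of_measure_preimage_closedBall_le {L : ℝ≥0} (hf : LipschitzWith L f)
    (hL : 1 ≤ L) (p : X) {z : Fin n → ℝ} (hfin : (f ⁻¹' {z}).Finite) {M r : ℝ} (hM : 0 ≤ M)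
    (hr : 0 < r)
    (hz : ∀ s, 0 < s → s ≤ r → μH[n] (f ⁻¹' closedBall z s) ≤ ENNReal.ofReal (M * s ^ n)) :
    ∃ S : (Fin n → ℝ) → ℝ≥0∞, Measurable S ∧
      ∫⁻ w in closedBall z r, S w ≤ ENNReal.ofReal (n * 2 ^ (n + 2) * L ^ n * M * r * r ^ n) ∧
      ∀ w ∈ closedBall z r, ∃ N : Set ℝ, volume N ≤ S w ∧
        ∀ c ∉ N, (IsEssentialOn f p c z ↔ IsEssentialOn f p c w) := by
  let B : ℕ → Fin n → Set (Fin n → ℝ) := fun k i =>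
    distReplaced f p i (closedBall z ((1 / 2) ^ k * r))
  have hB : ∀ k i, MeasurableSet (B k i) := fun k i =>
    (isCompact_distReplaced hf.continuous p i isClosed_closedBall).measurableSet
  have hcont : ∀ k i, Continuous fun w : Fin n → ℝ => staircase z w k i := by
    intro k i
    unfold staircase
    fun_prop
  have hmeas : ∀ k (i : Fin n), Measurable fun w : Fin n → ℝ =>
      volume {c : ℝ | Function.update (staircase z w k i) i c ∈ B k i} := fun k i =>
    (measurable_volume_update (hB k i) i).comp (hcont k i).measurable
  have hterm : ∀ k (i : Fin n), ∫⁻ w in closedBall z r,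
      volume {c : ℝ | Function.update (staircase z w k i) i c ∈ B k i} ≤
        ENNReal.ofReal (2 ^ (n + 1) * L ^ n * M * r * r ^ n * (1 / 2) ^ k) := by
    intro k i
    refine (setLIntegral_volume_update_diagonal_le (hB k i) i z hr.le (s := (1 / 2) ^ k)
      (a := (1 / 2) ^ (k + 1)) (by positivity) (D := fun j =>
        if j.val < i then (1 / 2 : ℝ) ^ (k + 1) else (1 / 2) ^ k) (fun j => ?_) (fun j => ?_)
        (by positivity)).trans ?_
    · split_ifs
      · exact le_rfl
      · exact pow_le_pow_of_le_one (by norm_num) (by norm_num) (Nat.le_succ k)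
    · split_ifs
      · exact pow_le_pow_of_le_one (by norm_num) (by norm_num) (Nat.le_succ k)
      · exact le_rfl
    have h1 : volume (B k i) ≤ ENNReal.ofReal (L ^ n * (M * ((1 / 2) ^ k * r) ^ n)) := by
      refine (volume_distReplaced_le hf hL p i _).trans ?_
      rw [ENNReal.ofReal_mul (by positivity), ENNReal.ofReal_pow (by positivity),
        ENNReal.ofReal_coe_nnreal]
      gcongr
      refine hz _ (by positivity) ?_
      exact mul_le_of_le_one_left hr.le (pow_le_one₀ (by norm_num) (by norm_num))
    refine (mul_le_mul_right h1 _).trans ?_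
    rw [← ENNReal.ofReal_mul (by positivity)]
    refine ENNReal.ofReal_le_ofReal (le_of_eq ?_)
    have h2 : ((1 / 2 : ℝ) ^ k) ^ n ≠ 0 := by positivity
    have h3 : (((1 / 2 : ℝ) ^ (k + 1)) ^ n)⁻¹ = (((1 / 2 : ℝ) ^ k) ^ n)⁻¹ * 2 ^ n := by
      rw [pow_succ, mul_pow, mul_inv, ← inv_pow (1 / 2 : ℝ), one_div, inv_inv]
    rw [h3, mul_pow]
    field_simp
    ring
  refine ⟨fun w => ∑' k, ∑ i : Fin n,
    volume {c : ℝ | Function.update (staircase z w k i) i c ∈ B k i}, ?_, ?_, ?_⟩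
  · exact Measurable.tsum fun k => Finset.measurable_fun_sum _ fun i _ => hmeas k i
  · rw [lintegral_tsum fun k => (Finset.measurable_fun_sum _ fun i _ => hmeas k i).aemeasurable]
    calc _ ≤ ∑' k, ENNReal.ofReal
            (n * (2 ^ (n + 1) * L ^ n * M * r * r ^ n) * (1 / 2) ^ k) := by
          refine ENNReal.tsum_le_tsum fun k => ?_
          rw [lintegral_finsetSum _ fun i _ => hmeas k i]
          refine (Finset.sum_le_sum fun i _ => hterm k i).trans (le_of_eq ?_)
          rw [Finset.sum_const, Finset.card_univ, Fintype.card_fin, nsmul_eq_mul, mul_assoc (n : ℝ),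
            ENNReal.ofReal_mul (Nat.cast_nonneg n), ENNReal.ofReal_natCast]
      _ = ENNReal.ofReal (∑' k : ℕ, n * (2 ^ (n + 1) * L ^ n * M * r * r ^ n) * (1 / 2) ^ k) :=
          (ENNReal.ofReal_tsum_of_nonneg (fun k => by positivity)
            (summable_geometric_two.mul_left _)).symm
      _ ≤ _ := by
          rw [tsum_mul_left, tsum_geometric_two]
          refine ENNReal.ofReal_le_ofReal (le_of_eq ?_)
          ring
  · intro w hw
    refine ⟨(fun q => dist q p) '' (f ⁻¹' {z}) ∪ ⋃ k, ⋃ i : Fin n,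
      {c : ℝ | Function.update (staircase z w k i) i c ∈ B k i}, ?_, fun c hc => ?_⟩
    · refine (measure_union_le _ _).trans ?_
      rw [(hfin.image _).measure_zero, zero_add]
      refine (measure_iUnion_le _).trans (ENNReal.tsum_le_tsum fun k => ?_)
      exact measure_iUnion_fintype_le _ _
    · simp only [mem_union, mem_iUnion, not_or, not_exists, mem_ofPred_eq] at hc
      exact isEssentialOn_iff_of_staircase hf.continuous hr.le hw
        (fun q hq hqz => hc.1 ⟨q, hqz, hq⟩) hc.2

end Blocking

section Selection

variable {X : Type*} [MetricSpace X] [CompactSpace X] [MeasurableSpace X] [BorelSpace X] {n : ℕ}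
  {f : X → Fin n → ℝ} {L : ℝ≥0}

theorem le_mul_dist_of_isEssentialOn (hf : LipschitzWith L f) (hL : 1 ≤ L) {p : X}
    {z z' : Fin n → ℝ} (hfin : (f ⁻¹' {z}).Finite) (hfin' : (f ⁻¹' {z'}).Finite) {M r₀ t : ℝ}
    (hM : 0 ≤ M)
    (hz : ∀ s, 0 < s → s ≤ r₀ → μH[n] (f ⁻¹' closedBall z s) ≤ ENNReal.ofReal (M * s ^ n))
    (hz' : ∀ s, 0 < s → s ≤ r₀ → μH[n] (f ⁻¹' closedBall z' s) ≤ ENNReal.ofReal (M * s ^ n))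
    (hne : z ≠ z') (hr₀ : dist z z' ≤ r₀)
    (ht : ∀ c ∈ Ioo 0 t, IsEssentialOn f p c z ∧ ¬ IsEssentialOn f p c z') :
    t ≤ 2 * (n * 2 ^ (n + 2) * L ^ n * M) * dist z z' := by
  set r := dist z z' with hr_def
  have hr : 0 < r := dist_pos.2 hne
  obtain ⟨S, hSm, hSint, hS⟩ := exists_lintegral_le_of_measure_preimage_closedBall_le hf hL p hfin
    hM hr fun s hs hsr => hz s hs (hsr.trans hr₀)
  obtain ⟨S', -, hSint', hS'⟩ := exists_lintegral_le_of_measure_preimage_closedBall_le hf hL p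
    hfin' hM hr fun s hs hsr => hz' s hs (hsr.trans hr₀)
  let Q : Set (Fin n → ℝ) := closedBall (midpoint ℝ z z') (r / 2)
  have hQ : Q ⊆ closedBall z r := by
    refine closedBall_subset_closedBall' ?_
    rw [dist_midpoint_left, Real.norm_ofNat, ← hr_def]
    linarith
  have hQ' : Q ⊆ closedBall z' r := by
    refine closedBall_subset_closedBall' ?_
    rw [dist_midpoint_right, Real.norm_ofNat, ← hr_def]
    linarith
  have hpt : ∀ w ∈ Q, ENNReal.ofReal t ≤ S w + S' w := by
    intro w hw
    obtain ⟨N, hN, h⟩ := hS w (hQ hw)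
    obtain ⟨N', hN', h'⟩ := hS' w (hQ' hw)
    calc ENNReal.ofReal t = volume (Ioo 0 t) := by rw [Real.volume_Ioo, sub_zero]
      _ ≤ volume (N ∪ N') := by
          refine measure_mono fun c hc => ?_
          by_contra hcN
          rw [mem_union, not_or] at hcN
          exact (ht c hc).2 ((h' c hcN.2).2 ((h c hcN.1).1 (ht c hc).1))
      _ ≤ volume N + volume N' := measure_union_le _ _
      _ ≤ _ := add_le_add hN hN'
  have hvol : volume Q = ENNReal.ofReal (r ^ n) := by
    rw [Real.volume_pi_closedBall _ (by positivity), Fintype.card_fin, mul_div_cancel₀ _ two_ne_zero]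
  have hle : ENNReal.ofReal t * ENNReal.ofReal (r ^ n) ≤
      ENNReal.ofReal (2 * (n * 2 ^ (n + 2) * L ^ n * M) * r) * ENNReal.ofReal (r ^ n) := by
    calc _ = ∫⁻ _ in Q, ENNReal.ofReal t := by rw [setLIntegral_const, hvol]
      _ ≤ ∫⁻ w in Q, (S w + S' w) := setLIntegral_mono' measurableSet_closedBall hpt
      _ = (∫⁻ w in Q, S w) + ∫⁻ w in Q, S' w := lintegral_add_left hSm _
      _ ≤ ENNReal.ofReal (n * 2 ^ (n + 2) * L ^ n * M * r * r ^ n) +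
          ENNReal.ofReal (n * 2 ^ (n + 2) * L ^ n * M * r * r ^ n) :=
        add_le_add ((lintegral_mono_set hQ).trans hSint) ((lintegral_mono_set hQ').trans hSint')
      _ = _ := by
          rw [← ENNReal.ofReal_add (by positivity) (by positivity),
            ← ENNReal.ofReal_mul (by positivity)]
          congr 1
          ring
  have hrn : 0 < r ^ n := by positivity
  rw [ENNReal.mul_le_mul_iff_left (by simpa using hrn) ENNReal.ofReal_ne_top] at hle
  exact (ENNReal.ofReal_le_ofReal_iff (by positivity)).1 hle

theorem volume_image_eq_zero_of_dist_le
    (hunrect : ∀ E : Set X, IsRectifiableSet n E → μH[n] E = 0) (hf : LipschitzWith L f)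
    {A : Set X} {K : ℝ≥0} (hA : ∀ x ∈ A, ∀ y ∈ A, dist x y ≤ K * dist (f x) (f y)) :
    volume (f '' A) = 0 := by
  rcases isEmpty_or_nonempty X with hX | hX
  · rw [A.eq_empty_of_isEmpty, image_empty, measure_empty]
  have hcl : ∀ x ∈ closure A, ∀ y ∈ closure A, dist x y ≤ K * dist (f x) (f y) := by
    have hsub : A ×ˢ A ⊆ {q : X × X | dist q.1 q.2 ≤ K * dist (f q.1) (f q.2)} :=
      fun q hq => hA _ hq.1 _ hq.2
    have hfc := hf.continuous
    have := closure_minimal hsub (isClosed_le (by fun_prop) (by fun_prop))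
    rw [closure_prod_eq] at this
    exact fun x hx y hy => this (mk_mem_prod hx hy)
  have hcpt : IsCompact (closure A) := isClosed_closure.isCompact
  have hinj : InjOn f (closure A) := by
    intro x hx y hy hxy
    have := hcl x hx y hy
    rw [hxy, dist_self, mul_zero] at this
    exact dist_le_zero.1 this
  have hzero : μH[n] (closure A) = 0 := by
    refine hunrect _ ⟨isClosed_closure.measurableSet,
      fun _ => (WithLp.ofLp : EuclideanSpace ℝ (Fin n) → _) ⁻¹' (f '' closure A),
      fun _ y => Function.invFunOn f (closure A) y.ofLp, fun _ => ?_, fun _ => ⟨K, ?_⟩, ?_⟩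
    · exact (((hcpt.image hf.continuous).isClosed).preimage
        (PiLp.continuous_ofLp 2 _)).measurableSet
    · refine LipschitzOnWith.of_dist_le_mul ?_
      rintro y hy y' hy'
      refine (hcl _ (Function.invFunOn_mem hy) _ (Function.invFunOn_mem hy')).trans ?_
      rw [Function.invFunOn_eq hy, Function.invFunOn_eq hy']
      gcongr
      simpa using (PiLp.lipschitzWith_ofLp 2 (fun _ : Fin n => ℝ)).dist_le_mul y y'
    · refine (congr_arg _ (sdiff_eq_empty.2 fun x hx => ?_)).trans measure_empty
      exact mem_iUnion.2 ⟨0, WithLp.toLp 2 (f x), ⟨x, hx, rfl⟩, hinj.leftInvOn_invFunOn hx⟩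
  refine measure_mono_null (image_mono subset_closure) ?_
  have := hf.hausdorffMeasure_image_le (d := n) (Nat.cast_nonneg n) (closure A)
  rw [hzero, mul_zero, nonpos_iff_eq_zero] at this
  rw [← hausdorffMeasure_pi_real, Fintype.card_fin]
  exact this

/-- Almost every value of a Lipschitz map from a compact purely unrectifiable space into `ℝ^n` can
be avoided by an arbitrarily small continuous perturbation. -/
theorem ae_exists_forall_ne_and_dist_le
    (hunrect : ∀ E : Set X, IsRectifiableSet n E → μH[n] E = 0)
    (hfin : μH[n] (univ : Set X) < ∞) (hf : LipschitzWith L f) (hL : 1 ≤ L) :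
    ∀ᵐ z : Fin n → ℝ, ∀ ε > 0, ∃ g : X → Fin n → ℝ, Continuous g ∧ (∀ x, g x ≠ z) ∧
      ∀ x, dist (g x) (f x) ≤ ε := by
  rcases isEmpty_or_nonempty X with hX | hX
  · exact Eventually.of_forall fun z ε _ => ⟨f, hf.continuous, fun x => (hX.false x).elim,
      fun x => (hX.false x).elim⟩
  have : IsFiniteMeasure (μH[n] : Measure X) := ⟨hfin⟩
  have hfib : ∀ᵐ z : Fin n → ℝ, (f ⁻¹' {z}).Finite := by
    refine ae_finite_preimage_singleton (μ := μH[n]) (C := (L : ℝ≥0∞) ^ n)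
      (ENNReal.pow_ne_top ENNReal.coe_ne_top) fun s => ?_
    have := hf.hausdorffMeasure_image_le (d := n) (Nat.cast_nonneg n) s
    rw [ENNReal.rpow_natCast] at this
    rw [← hausdorffMeasure_pi_real, Fintype.card_fin]
    exact this
  have hdens := ae_exists_measure_closedBall_le ((μH[n] : Measure X).map f)
  let A : ℕ → Set X := fun m => {x | (f ⁻¹' {f x}).Finite ∧
    (∀ s, 0 < s → s < 1 / (m + 1 : ℝ) →
      μH[n] (f ⁻¹' closedBall (f x) s) ≤ ENNReal.ofReal (m * s ^ n)) ∧
    (∀ c ∈ Ioo 0 (1 / (m + 1 : ℝ)), IsEssentialOn f x c (f x)) ∧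
    ∀ y, f y = f x → dist y x < 1 / (m + 1 : ℝ) → y = x}
  have hA : ∀ m, volume (f '' A m) = 0 := by
    intro m
    set δ : ℝ := 1 / (m + 1) with hδ_def
    have hδ : 0 < δ := by positivity
    obtain ⟨P, -, -, hPu, hP⟩ :=
      exists_measurable_partition_dist_le (X := X) (show 0 < δ / 4 by positivity)
    have hsub : f '' A m ⊆ ⋃ j, f '' (A m ∩ P j) := by
      rw [← image_iUnion, ← inter_iUnion, hPu, inter_univ]
    refine measure_mono_null hsub (measure_iUnion_null fun j => ?_)
    let K₀ : ℝ≥0 := 2 * (n * 2 ^ (n + 2) * L ^ n * m)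
    refine volume_image_eq_zero_of_dist_le hunrect hf (K := K₀ + 1) ?_
    rintro x ⟨⟨hx1, hx2, hx3, hx4⟩, hxP⟩ y ⟨⟨hy1, hy2, hy3, hy4⟩, hyP⟩
    have hd : dist x y ≤ δ / 4 := hP j x hxP y hyP
    have hK₀ : 0 ≤ (K₀ : ℝ) := K₀.2
    have hr0 : 0 ≤ dist (f x) (f y) := dist_nonneg
    push_cast
    by_cases hxy : f x = f y
    · rw [hy4 x hxy (by linarith), dist_self]
      positivity
    rcases le_or_gt (δ / 2) (dist (f x) (f y)) with hfar | hnear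
    · nlinarith
    suffices h : dist x y ≤ K₀ * dist (f x) (f y) by linarith
    by_contra! hlt
    have hex : ∃ c ∈ Ioo 0 (dist x y), IsEssentialOn f x c (f y) := by
      by_contra! hno
      refine hlt.not_ge ?_
      refine (le_mul_dist_of_isEssentialOn hf hL (p := x) (r₀ := δ / 2) hx1 hy1
        (Nat.cast_nonneg m) (fun s hs hsr => hx2 s hs (by linarith))
        (fun s hs hsr => hy2 s hs (by linarith)) hxy hnear.le
        (fun c hc => ⟨hx3 c ⟨hc.1, by linarith [hc.2]⟩, hno c hc⟩)).trans (le_of_eq ?_)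
      simp [K₀]
    obtain ⟨c, hc, hess⟩ := hex
    obtain ⟨q, hqx, hqy⟩ := hess f hf.continuous fun _ _ => rfl
    have hq : q = y := hy4 q hqy (by
      have := dist_triangle q x y
      linarith [hc.2])
    rw [hq, dist_comm] at hqx
    exact hqx.not_gt hc.2
  have hAae : ∀ᵐ z : Fin n → ℝ, ∀ m, z ∉ f '' A m :=
    ae_all_iff.2 fun m => measure_eq_zero_iff_ae_notMem.1 (hA m)
  filter_upwards [hfib, hdens, hAae] with z hz1 ⟨m₁, hm₁⟩ hz3 ε hε
  refine exists_forall_ne_and_dist_le hf.continuous hz1 (fun x hx ρ hρ => ?_) hε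
  by_contra! hess
  obtain ⟨δ, hδ, hsep⟩ := exists_pos_lt_dist_of_finite hz1
  obtain ⟨m₂, hm₂⟩ := exists_nat_one_div_lt hρ
  obtain ⟨m₃, hm₃⟩ := exists_nat_one_div_lt hδ
  let m := max m₁ (max m₂ m₃)
  have hanti : ∀ k ≤ m, (1 : ℝ) / (m + 1) ≤ 1 / (k + 1) := fun k hk => by gcongr
  have h1 := hanti m₁ (le_max_left _ _)
  have h2 := hanti m₂ (le_max_of_le_right (le_max_left _ _))
  have h3 := hanti m₃ (le_max_of_le_right (le_max_right _ _))
  refine hz3 m ⟨x, ⟨hx ▸ hz1, fun s hs hsm => ?_, fun c hc => ?_, fun y hy hyx => ?_⟩, hx⟩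
  · have := hm₁ s hs (hsm.trans_le h1)
    rw [Measure.map_apply hf.continuous.measurable measurableSet_closedBall] at this
    rw [hx]
    refine this.trans (ENNReal.ofReal_le_ofReal ?_)
    gcongr
    exact le_max_left _ _
  · rw [hx]
    exact hess c ⟨hc.1, hc.2.trans_le (h2.trans hm₂.le)⟩
  · by_contra hne
    have := hsep y (hy.trans hx) x hx hne
    linarith

end Selection

section Reduction

/-- Lipschitz functions on a compact space are uniformly dense in the continuous ones. -/
theorem Continuous.exists_lipschitzWith_dist_le {X : Type*} [MetricSpace X] [CompactSpace X]
    {u : X → ℝ} (hu : Continuous u) {η : ℝ} (hη : 0 < η) :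
    ∃ (L : ℝ≥0) (v : X → ℝ), LipschitzWith L v ∧ ∀ x, dist (v x) (u x) ≤ η := by
  rcases isEmpty_or_nonempty X with hX | hX
  · exact ⟨0, u, fun x => (hX.false x).elim, fun x => (hX.false x).elim⟩
  obtain ⟨C, hC⟩ := isCompact_univ.exists_bound_of_continuousOn hu.continuousOn
  replace hC : ∀ x, |u x| ≤ C := fun x => hC x (mem_univ x)
  have hC0 : 0 ≤ C := (abs_nonneg _).trans (hC (Classical.arbitrary X))
  obtain ⟨δ, hδ, hδu⟩ := Metric.uniformContinuous_iff.1
    (CompactSpace.uniformContinuous_of_continuous hu) η hη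
  let K : ℝ≥0 := ⟨2 * C / δ, by positivity⟩
  have hK : (K : ℝ) = 2 * C / δ := rfl
  have hbdd : ∀ x, BddBelow (range fun y => u y + K * dist x y) := fun x => by
    refine ⟨-C, ?_⟩
    rintro _ ⟨y, rfl⟩
    have := neg_le_of_abs_le (hC y)
    have : 0 ≤ K * dist x y := by positivity
    dsimp only
    linarith
  refine ⟨K, fun x => ⨅ y, u y + K * dist x y, LipschitzWith.of_le_add_mul K fun x x' => ?_,
    fun x => ?_⟩
  · rw [← sub_le_iff_le_add]
    refine le_ciInf fun y => ?_
    rw [sub_le_iff_le_add]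
    refine (ciInf_le (hbdd x) y).trans ?_
    have := mul_le_mul_of_nonneg_left (dist_triangle x x' y) K.2
    change (K : ℝ) * dist x y ≤ K * (dist x x' + dist x' y) at this
    linarith
  · rw [Real.dist_eq, abs_le]
    constructor
    · rw [neg_le_sub_iff_le_add, ← sub_le_iff_le_add]
      refine le_ciInf fun y => ?_
      rcases lt_or_ge (dist x y) δ with h | h
      · have h1 := hδu h
        rw [Real.dist_eq] at h1
        have := (abs_lt.1 h1).2
        have : 0 ≤ K * dist x y := by positivity
        linarith
      · have h1 : 2 * C ≤ K * dist x y := by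
          rw [hK, div_mul_eq_mul_div, le_div_iff₀ hδ]
          gcongr
        have := (abs_le.1 (hC x)).2
        have := (abs_le.1 (hC y)).1
        linarith
    · have := ciInf_le (hbdd x) x
      rw [dist_self, mul_zero, add_zero] at this
      linarith

theorem Continuous.exists_lipschitzWith_pi_dist_le {X : Type*} [MetricSpace X] [CompactSpace X]
    {n : ℕ} {u : X → Fin n → ℝ} (hu : Continuous u) {η : ℝ} (hη : 0 < η) :
    ∃ (L : ℝ≥0) (v : X → Fin n → ℝ), 1 ≤ L ∧ LipschitzWith L v ∧ ∀ x, dist (v x) (u x) ≤ η := by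
  choose L v hv hvu using fun i => ((continuous_apply i).comp hu).exists_lipschitzWith_dist_le hη
  refine ⟨1 + ∑ i, L i, fun x i => v i x, le_self_add, LipschitzWith.of_dist_le_mul fun x y => ?_,
    fun x => (dist_pi_le_iff hη.le).2 fun i => hvu i x⟩
  refine (dist_pi_le_iff (by positivity)).2 fun i => ((hv i).dist_le_mul x y).trans ?_
  gcongr
  exact (Finset.single_le_sum (fun _ _ => zero_le) (Finset.mem_univ i)).trans le_add_self

end Reduction

section Cube

variable {X : Type*} [MetricSpace X] {n : ℕ} {g : X → EuclideanSpace ℝ (Fin n)}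

theorem not_isStableValue_of_forall_exists (y : EuclideanSpace ℝ (Fin n))
    (h : ∀ ε > 0, ∃ g' : X → EuclideanSpace ℝ (Fin n), Continuous g' ∧ (∀ x, g' x ∈ unitCube n) ∧
      (∀ x, g' x ≠ y) ∧ ∀ x, dist (g' x) (g x) ≤ ε) : ¬ IsStableValue g y := by
  rintro ⟨ε, hε, hstab⟩
  obtain ⟨g', hg', hcube, hne, hdist⟩ := h (ε / 2) (by positivity)
  obtain ⟨x, hx⟩ := hstab g' hg' hcube
    ((Real.iSup_le hdist (by positivity)).trans_lt (half_lt_self hε))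
  exact hne x hx

theorem not_isStableValue_of_boundary [CompactSpace X] (hg : Continuous g)
    (hcube : ∀ x, g x ∈ unitCube n) {y : EuclideanSpace ℝ (Fin n)}
    (hy : ∃ i, y i ≤ 0 ∨ 1 ≤ y i) : ¬ IsStableValue g y := by
  refine not_isStableValue_of_forall_exists y fun ε hε => ?_
  let c : EuclideanSpace ℝ (Fin n) := WithLp.toLp 2 fun _ => 1 / 2
  obtain ⟨C, hC⟩ := isCompact_univ.exists_bound_of_continuousOn
    (f := fun x => c - g x) (by fun_prop)
  obtain ⟨t, ht0, ht⟩ : ∃ t > 0, t < min 1 (ε / (|C| + 1)) := exists_between (by positivity)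
  have ht1 := ht.trans_le (min_le_left _ _)
  have htε := (ht.trans_le (min_le_right _ _)).le
  rw [le_div_iff₀ (by positivity)] at htε
  have hcoord : ∀ x i, (g x + t • (c - g x)) i = g x i + t * (1 / 2 - g x i) := fun x i => by
    simp [c]
  have hIoo : ∀ x i, (g x + t • (c - g x)) i ∈ Ioo (0 : ℝ) 1 := fun x i => by
    rw [hcoord]
    obtain ⟨h0, h1⟩ := hcube x i
    constructor <;> nlinarith
  refine ⟨fun x => g x + t • (c - g x), by fun_prop, fun x i => Ioo_subset_Icc_self (hIoo x i),
    fun x hx => ?_, fun x => ?_⟩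
  · obtain ⟨i, hi⟩ := hy
    have : y i ∈ Ioo (0 : ℝ) 1 := hx ▸ hIoo x i
    rcases hi with hi | hi
    · exact hi.not_gt this.1
    · exact hi.not_gt this.2
  · rw [dist_eq_norm, add_sub_cancel_left, norm_smul, Real.norm_of_nonneg ht0.le]
    refine le_trans ?_ htε
    gcongr
    linarith [hC x (mem_univ x), le_abs_self C]

end Cube

/-- If `X` is a compact, purely `n`-unrectifiable metric space with `H^n(X) < ∞` and positive
lower `n`-density `H^n`-a.e., then no continuous map `g : X → [0,1]^n` has a stable value. -/
theorem stmt8 {X : Type*} [MetricSpace X] [MeasurableSpace X] [BorelSpace X]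
    [CompactSpace X] (n : ℕ)
    (hunrect : ∀ E : Set X, IsRectifiableSet n E → μH[n] E = 0)
    (hfin : μH[n] (univ : Set X) < ∞)
    (hld : ∀ᵐ x ∂(μH[n] : Measure X),
      0 < liminf (fun r : ℝ => μH[n] (closedBall x r) / ENNReal.ofReal (r ^ n)) (𝓝[>] 0)) :
    ∀ g : X → EuclideanSpace ℝ (Fin n), Continuous g → (∀ x, g x ∈ unitCube n) →
      ∀ y : EuclideanSpace ℝ (Fin n), ¬ IsStableValue g y := by
  intro g hg hcube y
  by_cases hy : ∃ i, y i ≤ 0 ∨ 1 ≤ y i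
  · exact not_isStableValue_of_boundary hg hcube hy
  push Not at hy
  refine not_isStableValue_of_forall_exists y fun ε hε => ?_
  obtain ⟨K, hK⟩ : ∃ K : ℝ≥0, LipschitzWith K
      (WithLp.toLp 2 : (Fin n → ℝ) → EuclideanSpace ℝ (Fin n)) :=
    ⟨_, PiLp.lipschitzWith_toLp 2 fun _ => ℝ⟩
  set η : ℝ := ε / (3 * (K + 1)) with hη_def
  have hη : 0 < η := by positivity
  obtain ⟨L, f, hL, hf, hfg⟩ :=
    (show Continuous fun x => (g x).ofLp by fun_prop).exists_lipschitzWith_pi_dist_le hη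
  obtain ⟨z, hz, hzy⟩ := (Measure.dense_of_ae
    (ae_exists_forall_ne_and_dist_le hunrect hfin hf hL)).exists_dist_lt y.ofLp hη
  obtain ⟨h, hh, hne, hhf⟩ := hz η hη
  let v : X → Fin n → ℝ := fun x i => max 0 (min 1 (h x i + y i - z i))
  have hvc : Continuous v := by fun_prop
  refine ⟨fun x => WithLp.toLp 2 (v x), by fun_prop, fun x i => ?_, fun x hx => ?_, fun x => ?_⟩
  · exact ⟨le_max_left _ _, max_le zero_le_one (min_le_left _ _)⟩
  · refine hne x (funext fun i => ?_)
    have hi : v x i = y i := congr_arg (fun w : EuclideanSpace ℝ (Fin n) => w i) hx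
    obtain ⟨h0, h1⟩ := hy i
    simp only [v] at hi
    grind
  · have hv : dist (v x) (g x).ofLp ≤ 3 * η := by
      refine (dist_pi_le_iff (by positivity)).2 fun i => ?_
      obtain ⟨h0, h1⟩ := hcube x i
      have e1 := (dist_le_pi_dist (h x) (f x) i).trans (hhf x)
      have e2 := (dist_le_pi_dist (f x) _ i).trans (hfg x)
      have e3 := (dist_le_pi_dist _ z i).trans hzy.le
      simp only [Real.dist_eq, abs_le] at e1 e2 e3 ⊢
      simp only [v]
      grind
    refine (hK.dist_le_mul (v x) (g x).ofLp).trans ?_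
    have hε3 : 3 * η * (K + 1) = ε := by
      rw [hη_def]
      field_simp
    nlinarith [K.2]
end

section
/- Let X be a compact topological n-manifold equipped with a metric inducing its topology, with H^n(X) < ∞, and suppose that for H^n-almost every x in X one has liminf_{r→0} H^n(B(x,r))/r^n > 0. Then every nonempty open subset of X contains an n-rectifiable subset of positive H^n-measure. -/
open MeasureTheory Metric Set Filter
open scoped ENNReal NNReal Topology

namespace MetricManifold

section Covering

variable {Y : Type*} [MetricSpace Y] [MeasurableSpace Y] [BorelSpace Y]

/-- A `5r`-covering lemma with a bound on the radii in terms of a measure. -/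
theorem exists_countable_cover [TopologicalSpace.SeparableSpace Y] (ν : Measure Y) (n : ℕ)
    {E S : Set Y} {ρ : Y → ℝ} {R : ℝ} {t : ℝ≥0∞} (hρ : ∀ z ∈ E, 0 < ρ z ∧ ρ z ≤ R)
    (hS : ∀ z ∈ E, closedBall z (ρ z) ⊆ S)
    (h : ∀ z ∈ E, ENNReal.ofReal (ρ z) ^ n ≤ t * ν (closedBall z (ρ z))) :
    ∃ u ⊆ E, u.Countable ∧ E ⊆ ⋃ z ∈ u, closedBall z (5 * ρ z) ∧
      ∑' z : u, ENNReal.ofReal (ρ z) ^ n ≤ t * ν S := by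
  obtain ⟨u, huE, hdisj, hcov⟩ := Vitali.exists_disjoint_subfamily_covering_enlargement_closedBall
    E id ρ R (fun z hz => (hρ z hz).2) 5 (by norm_num)
  simp only [id] at hdisj hcov
  have hcount : u.Countable := by
    refine hdisj.countable_of_nonempty_interior fun z hz => ⟨z, ?_⟩
    exact ball_subset_interior_closedBall (mem_ball_self (hρ z (huE hz)).1)
  refine ⟨u, huE, hcount, fun z hz => ?_, ?_⟩
  · obtain ⟨b, hb, hsub⟩ := hcov z hz
    exact mem_biUnion hb (hsub (mem_closedBall_self (hρ z hz).1.le))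
  · have := hcount.to_subtype
    calc ∑' z : u, ENNReal.ofReal (ρ z) ^ n
        ≤ ∑' z : u, t * ν (closedBall (z : Y) (ρ z)) :=
          ENNReal.tsum_le_tsum fun z => h z (huE z.2)
      _ = t * ν (⋃ z ∈ u, closedBall z (ρ z)) := by
          rw [ENNReal.tsum_mul_left,
            measure_biUnion hcount hdisj fun z _ => isClosed_closedBall.measurableSet]
      _ ≤ t * ν S := by
          gcongr
          exact iUnion₂_subset fun z hz => hS z (huE hz)

theorem hausdorffMeasure_le_of_upper_density [TopologicalSpace.SeparableSpace Y] (ν : Measure Y)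
    (n : ℕ) {E U : Set Y} {t : ℝ≥0∞} (hU : IsOpen U) (hEU : E ⊆ U)
    (h : ∀ x ∈ E, ∀ δ > 0, ∃ r, 0 < r ∧ r < δ ∧
      ENNReal.ofReal r ^ n ≤ t * ν (closedBall x r)) :
    μH[n] E ≤ 10 ^ n * (t * ν U) := by
  have key : ∀ m : ℕ, ∃ u : Set Y, ∃ ρ : Y → ℝ, u.Countable ∧
      E ⊆ ⋃ z ∈ u, closedBall z (5 * ρ z) ∧ (∀ z ∈ u, ρ z < 1 / (m + 1 : ℝ)) ∧
      ∑' z : u, ENNReal.ofReal (ρ z) ^ n ≤ t * ν U := by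
    intro m
    have : ∀ x ∈ E, ∃ r, 0 < r ∧ r < 1 / (m + 1 : ℝ) ∧ closedBall x r ⊆ U ∧
        ENNReal.ofReal r ^ n ≤ t * ν (closedBall x r) := by
      intro x hx
      obtain ⟨δ, hδ, hδU⟩ := Metric.isOpen_iff.1 hU x (hEU hx)
      obtain ⟨r, hr0, hr, hrn⟩ := h x hx (min δ (1 / (m + 1 : ℝ))) (by positivity)
      exact ⟨r, hr0, hr.trans_le (min_le_right _ _),
        (closedBall_subset_ball (hr.trans_le (min_le_left _ _))).trans hδU, hrn⟩
    choose! ρ h1 h2 h3 h4 using this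
    obtain ⟨u, huE, hc, hcov, hsum⟩ := exists_countable_cover ν n
      (fun z hz => ⟨h1 z hz, (h2 z hz).le⟩) h3 h4
    exact ⟨u, ρ, hc, hcov, fun z hz => h2 z (huE hz), hsum⟩
  choose u ρ hc hcov hlt hsum using key
  have : ∀ m, Countable (u m) := fun m => (hc m).to_subtype
  have hdiam : ∀ m, ∀ z : Y, ediam (closedBall z (5 * ρ m z)) ≤ 10 * ENNReal.ofReal (ρ m z) := by
    intro m z
    rcases le_total (ρ m z) 0 with h0 | h0
    · refine (ediam_mono (closedBall_subset_closedBall (ε₂ := 0) (by linarith))).trans ?_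
      simp
    · calc ediam (closedBall z (5 * ρ m z)) 
          = ediam (closedEBall z (ENNReal.ofReal (5 * ρ m z))) := by
            rw [closedEBall_ofReal (by positivity)]
        _ ≤ 2 * ENNReal.ofReal (5 * ρ m z) := ediam_closedEBall_le
        _ = 10 * ENNReal.ofReal (ρ m z) := by
            rw [ENNReal.ofReal_mul (by norm_num), ← mul_assoc]; norm_num
  have hlim : Tendsto (fun m : ℕ => 10 * ENNReal.ofReal (1 / (m + 1 : ℝ))) atTop (𝓝 0) := by
    have := ENNReal.Tendsto.const_mul (a := 10) (ENNReal.tendsto_ofReal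
      (tendsto_one_div_add_atTop_nhds_zero_nat (𝕜 := ℝ))) (Or.inr (by norm_num))
    simpa using this
  refine (Measure.hausdorffMeasure_le_liminf_tsum n E _ hlim
    (fun m (z : u m) => closedBall (z : Y) (5 * ρ m z)) ?_ ?_).trans ?_
  · refine Eventually.of_forall fun m z => (hdiam m z).trans ?_
    gcongr
    exact (hlt m z z.2).le
  · refine Eventually.of_forall fun m => ?_
    simpa [iUnion_subtype] using hcov m
  · refine (liminf_le_liminf (Eventually.of_forall fun m => ?_)).trans (liminf_const _).le
    calc ∑' z : u m, ediam (closedBall (z : Y) (5 * ρ m z)) ^ (n : ℝ)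
        ≤ ∑' z : u m, 10 ^ n * ENNReal.ofReal (ρ m z) ^ n := by
          refine ENNReal.tsum_le_tsum fun z => ?_
          rw [ENNReal.rpow_natCast, ← mul_pow]
          gcongr
          exact hdiam m z
      _ ≤ 10 ^ n * (t * ν U) := by
          rw [ENNReal.tsum_mul_left]
          gcongr
          exact hsum m

end Covering

section Density

variable {X : Type*} [MetricSpace X] [MeasurableSpace X] [BorelSpace X] {n : ℕ}

/-- The set of points at which balls of radius less than `1 / k` have measure comparable
to the `n`-th power of the radius, with constant `k`. -/
def regularPoints (X : Type*) [MetricSpace X] [MeasurableSpace X] [BorelSpace X]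
    (n : ℕ) (k : ℝ) : Set X :=
  {x | ∀ r, 0 < r → r < 1 / k →
    ENNReal.ofReal (r ^ n / k) ≤ μH[n] (closedBall x r) ∧
      μH[n] (closedBall x r) ≤ ENNReal.ofReal (k * r ^ n)}

theorem regularPoints_mono {k l : ℝ} (hk : 0 < k) (hkl : k ≤ l) :
    regularPoints X n k ⊆ regularPoints X n l := by
  intro x hx r hr hrl
  obtain ⟨h1, h2⟩ := hx r hr (hrl.trans_le (by gcongr))
  exact ⟨(ENNReal.ofReal_le_ofReal (by gcongr)).trans h1,
    h2.trans (ENNReal.ofReal_le_ofReal (by gcongr))⟩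

theorem closure_regularPoints_subset {k : ℝ} (hk : 0 < k) :
    closure (regularPoints X n k) ⊆ regularPoints X n (2 ^ (n + 1) * k) := by
  intro x hx r hr hrl
  have h2n : (1 : ℝ) ≤ 2 ^ n := one_le_pow₀ (by norm_num)
  have hr' : 2 * r < 1 / k := by
    rw [lt_div_iff₀ (by positivity)] at hrl ⊢
    rw [pow_succ] at hrl
    have : 2 * r * k ≤ 2 ^ n * (2 * r * k) := le_mul_of_one_le_left (by positivity) h2n
    linarith
  obtain ⟨y, hy, hxy⟩ := Metric.mem_closure_iff.1 hx (r / 2) (by positivity)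
  have hyx : dist y x < r / 2 := by rwa [dist_comm]
  constructor
  · calc ENNReal.ofReal (r ^ n / (2 ^ (n + 1) * k)) ≤ ENNReal.ofReal ((r / 2) ^ n / k) := by
          apply ENNReal.ofReal_le_ofReal
          rw [div_pow, div_div]
          gcongr
          · norm_num
          · omega
      _ ≤ μH[n] (closedBall y (r / 2)) := (hy _ (by positivity) (by linarith)).1
      _ ≤ _ := measure_mono (closedBall_subset_closedBall' (by linarith))
  · calc μH[n] (closedBall x r) ≤ μH[n] (closedBall y (2 * r)) :=
          measure_mono (closedBall_subset_closedBall' (by linarith))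
      _ ≤ ENNReal.ofReal (k * (2 * r) ^ n) := (hy _ (by positivity) hr').2
      _ ≤ _ := by
          apply ENNReal.ofReal_le_ofReal
          rw [mul_pow, pow_succ]
          have : 0 ≤ 2 ^ n * k * r ^ n := by positivity
          nlinarith

variable [CompactSpace X]

/-- Almost every point of a measurable set `P` is a point of `n`-dimensional
zero density of the complement of `P`. -/
theorem ae_density_compl (hfin : μH[n] (univ : Set X) < ∞) {P : Set X} (hP : MeasurableSet P)
    {c : ℝ} (hc : 0 < c) :
    μH[n] {x ∈ P | ∀ δ > 0, ∃ r, 0 < r ∧ r < δ ∧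
      ENNReal.ofReal (c * r ^ n) ≤ μH[n] (closedBall x r \ P)} = 0 := by
  have : IsFiniteMeasure (μH[n] : Measure X) := ⟨hfin⟩
  set E := {x ∈ P | ∀ δ > 0, ∃ r, 0 < r ∧ r < δ ∧
      ENNReal.ofReal (c * r ^ n) ≤ μH[n] (closedBall x r \ P)}
  set ν := (μH[n] : Measure X).restrict Pᶜ
  have hν : ν P = 0 := by simp [ν, Measure.restrict_apply hP]
  have hbound : ∀ η : ℝ≥0∞, 0 < η → μH[n] E ≤ 10 ^ n * (ENNReal.ofReal c⁻¹ * η) := by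
    intro η hη
    obtain ⟨U, hPU, hU, hUη⟩ := P.exists_isOpen_lt_of_lt (μ := ν) η (by rwa [hν])
    refine (hausdorffMeasure_le_of_upper_density ν n (t := ENNReal.ofReal c⁻¹) hU
      ((sep_subset _ _).trans hPU) ?_).trans (by gcongr)
    rintro x ⟨-, hx⟩ δ hδ
    obtain ⟨r, hr, hrδ, h⟩ := hx δ hδ
    refine ⟨r, hr, hrδ, ?_⟩
    rw [Measure.restrict_apply isClosed_closedBall.measurableSet, ← sdiff_eq]
    calc ENNReal.ofReal r ^ n = ENNReal.ofReal c⁻¹ * ENNReal.ofReal (c * r ^ n) := by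
          rw [← ENNReal.ofReal_mul (by positivity), ← ENNReal.ofReal_pow hr.le]
          congr 1
          field_simp
      _ ≤ _ := by gcongr
  refine le_antisymm (le_of_forall_gt fun a ha => ?_) (zero_le)
  have hlim : Tendsto (fun η : ℝ≥0∞ => 10 ^ n * (ENNReal.ofReal c⁻¹ * η)) (𝓝[>] 0) (𝓝 0) := by
    have : Tendsto (fun η : ℝ≥0∞ => 10 ^ n * (ENNReal.ofReal c⁻¹ * η)) (𝓝 0)
        (𝓝 (10 ^ n * (ENNReal.ofReal c⁻¹ * 0))) :=
      ENNReal.Tendsto.const_mul (ENNReal.Tendsto.const_mul tendsto_id (Or.inr (by simp)))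
        (Or.inr (by finiteness))
    simpa using this.mono_left nhdsWithin_le_nhds
  obtain ⟨η, h1, h2⟩ := ((hlim.eventually (gt_mem_nhds ha)).and self_mem_nhdsWithin).exists
  exact (hbound η h2).trans_lt h1

theorem ae_mem_regularPoints (hfin : μH[n] (univ : Set X) < ∞)
    (hld : ∀ᵐ x ∂(μH[n] : Measure X),
      0 < liminf (fun r : ℝ => μH[n] (closedBall x r) / ENNReal.ofReal (r ^ n)) (𝓝[>] 0)) :
    ∀ᵐ x ∂(μH[n] : Measure X), ∃ m : ℕ, x ∈ regularPoints X n (m + 1) := by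
  have hup : μH[n] {x : X | ∀ m : ℕ, ∀ δ > 0, ∃ r, 0 < r ∧ r < δ ∧
      ENNReal.ofReal ((m + 1) * r ^ n) ≤ μH[n] (closedBall x r)} = 0 := by
    set E := {x : X | ∀ m : ℕ, ∀ δ > 0, ∃ r, 0 < r ∧ r < δ ∧
      ENNReal.ofReal ((m + 1) * r ^ n) ≤ μH[n] (closedBall x r)}
    have hbound : ∀ m : ℕ, μH[n] E ≤
        10 ^ n * (ENNReal.ofReal (1 / (m + 1 : ℝ)) * μH[n] (univ : Set X)) := by
      intro m
      refine hausdorffMeasure_le_of_upper_density μH[n] n isOpen_univ (subset_univ _) ?_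
      intro x hx δ hδ
      obtain ⟨r, hr, hrδ, h⟩ := hx m δ hδ
      refine ⟨r, hr, hrδ, ?_⟩
      calc ENNReal.ofReal r ^ n
          = ENNReal.ofReal (1 / (m + 1 : ℝ)) * ENNReal.ofReal ((m + 1) * r ^ n) := by
            rw [← ENNReal.ofReal_mul (by positivity), ← ENNReal.ofReal_pow hr.le]
            congr 1
            field_simp
        _ ≤ _ := by gcongr
    have hlim : Tendsto (fun m : ℕ =>
        10 ^ n * (ENNReal.ofReal (1 / (m + 1 : ℝ)) * μH[n] (univ : Set X))) atTop
        (𝓝 (10 ^ n * (ENNReal.ofReal 0 * μH[n] (univ : Set X)))) :=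
      ENNReal.Tendsto.const_mul (ENNReal.Tendsto.mul_const (ENNReal.tendsto_ofReal
        tendsto_one_div_add_atTop_nhds_zero_nat) (Or.inr hfin.ne)) (Or.inr (by finiteness))
    have := ge_of_tendsto' hlim hbound
    simpa using this
  filter_upwards [hld, measure_eq_zero_iff_ae_notMem.1 hup] with x hx hx'
  obtain ⟨c, hc0, hc⟩ := exists_between hx
  have hev := eventually_lt_of_lt_liminf hc
  obtain ⟨δ₁, hδ₁, h1⟩ := mem_nhdsGT_iff_exists_Ioo_subset.1 hev
  simp only [not_forall, not_exists] at hx'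
  obtain ⟨m, δ₂, hδ₂, h2⟩ := hx'
  have hδ₁ : (0 : ℝ) < δ₁ := hδ₁
  obtain ⟨c', hc', hcc'⟩ : ∃ c' : ℝ, 0 < c' ∧ ENNReal.ofReal c' ≤ c := by
    refine ⟨(min c 1).toReal, ENNReal.toReal_pos (by simp [hc0.ne']) (by simp), ?_⟩
    rw [ENNReal.ofReal_toReal (by simp)]
    exact min_le_left _ _
  obtain ⟨N, hN⟩ := exists_nat_ge (max (max (1 / c') (1 / δ₁)) (max m (1 / δ₂)))
  simp only [max_le_iff] at hN
  obtain ⟨⟨hN1, hN2⟩, hN3, hN4⟩ := hN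
  refine ⟨N, fun r hr hrN => ?_⟩
  have hr1 : r < δ₁ := by
    refine hrN.trans_le ?_
    rw [div_le_comm₀ (by positivity) hδ₁]
    linarith
  have hr2 : r < δ₂ := by
    refine hrN.trans_le ?_
    rw [div_le_comm₀ (by positivity) hδ₂]
    linarith
  constructor
  · have := h1 ⟨hr, hr1⟩
    simp only [mem_ofPred_eq] at this
    have hr0 : ENNReal.ofReal (r ^ n) ≠ 0 := by simpa using pow_pos hr n
    calc ENNReal.ofReal (r ^ n / (N + 1)) ≤ ENNReal.ofReal c' * ENNReal.ofReal (r ^ n) := by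
          rw [← ENNReal.ofReal_mul hc'.le]
          apply ENNReal.ofReal_le_ofReal
          rw [div_eq_inv_mul]
          gcongr
          rw [inv_le_comm₀ (by positivity) hc']
          rw [one_div] at hN1
          linarith
      _ ≤ c * ENNReal.ofReal (r ^ n) := by gcongr
      _ ≤ _ := by
          rw [← ENNReal.le_div_iff_mul_le (Or.inl hr0) (Or.inl ENNReal.ofReal_ne_top)]
          exact this.le
  · have := h2 r
    simp only [not_and, not_le] at this
    refine (this hr hr2).le.trans (ENNReal.ofReal_le_ofReal (by gcongr))

/-- Up to small measure, a compact set consists of uniformly regular points. -/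
theorem exists_isCompact_regular (hfin : μH[n] (univ : Set X) < ∞)
    (hld : ∀ᵐ x ∂(μH[n] : Measure X),
      0 < liminf (fun r : ℝ => μH[n] (closedBall x r) / ENNReal.ofReal (r ^ n)) (𝓝[>] 0))
    {K : Set X} (hK : IsCompact K) {η : ℝ≥0∞} (hη : 0 < η) :
    ∃ A ⊆ K, IsCompact A ∧ μH[n] (K \ A) < η ∧ ∃ k : ℝ, 1 ≤ k ∧ A ⊆ regularPoints X n k := by
  have : IsFiniteMeasure (μH[n] : Measure X) := ⟨hfin⟩
  have hmono : Monotone fun m : ℕ => K ∩ regularPoints X n (m + 1) := by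
    intro a b hab
    have : (a : ℝ) ≤ b := by exact_mod_cast hab
    exact inter_subset_inter_right _ (regularPoints_mono (by positivity) (by linarith))
  have hfull : μH[n] (⋃ m : ℕ, K ∩ regularPoints X n (m + 1)) = μH[n] K := by
    rw [← inter_iUnion]
    refine measure_congr ?_
    filter_upwards [ae_mem_regularPoints hfin hld] with x hx
    have : x ∈ ⋃ m : ℕ, regularPoints X n (m + 1) := mem_iUnion.2 hx
    exact propext ⟨fun h => h.1, fun h => ⟨h, this⟩⟩
  rcases eq_or_ne (μH[n] K) 0 with h0 | h0
  · exact ⟨∅, empty_subset _, isCompact_empty, by simpa [h0] using hη, 1, le_rfl,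
      empty_subset _⟩
  rw [hmono.measure_iUnion] at hfull
  have hlt : μH[n] K - η < ⨆ m : ℕ, μH[n] (K ∩ regularPoints X n (m + 1)) := by
    rw [hfull]
    exact ENNReal.sub_lt_self (measure_ne_top _ K) h0 hη.ne'
  obtain ⟨m, hm⟩ := lt_iSup_iff.1 hlt
  set A := closure (K ∩ regularPoints X n (m + 1))
  have hAK : A ⊆ K := closure_minimal inter_subset_left hK.isClosed
  have hAc : IsCompact A := isClosed_closure.isCompact
  refine ⟨A, hAK, hAc, ?_, 2 ^ (n + 1) * (m + 1), ?_, ?_⟩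
  · rw [measure_sdiff hAK hAc.isClosed.measurableSet.nullMeasurableSet (measure_ne_top _ _)]
    have h1 : μH[n] K - η < μH[n] A := hm.trans_le (measure_mono subset_closure)
    rcases le_total η (μH[n] K) with h | h
    · exact ENNReal.sub_lt_of_sub_lt (measure_mono hAK) (Or.inl (measure_ne_top _ _)) h1
    · refine lt_of_lt_of_le (ENNReal.sub_lt_self (measure_ne_top _ K) h0 ?_) h
      exact (lt_of_le_of_lt (zero_le) h1).ne'
  · have h2n : (1 : ℝ) ≤ 2 ^ (n + 1) := one_le_pow₀ (by norm_num)
    have : (0 : ℝ) ≤ m := by positivity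
    nlinarith
  · exact (closure_mono inter_subset_right).trans (closure_regularPoints_subset (by positivity))

end Density

section RadialPush

variable {V : Type*} [NormedAddCommGroup V] [NormedSpace ℝ V]

/-- The map that expands the ball of radius `ρ` around `w` to the ball of radius `R`, pushes the
rest of the latter radially to its boundary, and fixes every point outside of it. -/
noncomputable def radialPush (w : V) (ρ R : ℝ) (z : V) : V :=
  w + (max R ‖z - w‖ / max ρ ‖z - w‖) • (z - w)

variable {w z : V} {ρ R : ℝ}

theorem radialPush_of_le (hρ : 0 < ρ) (hρR : ρ ≤ R) (hz : R ≤ ‖z - w‖) :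
    radialPush w ρ R z = z := by
  have h0 : ‖z - w‖ ≠ 0 := (by linarith : 0 < ‖z - w‖).ne'
  rw [radialPush, max_eq_right hz, max_eq_right (hρR.trans hz), div_self h0]
  simp

theorem norm_radialPush_sub (hρ : 0 < ρ) (hρR : ρ ≤ R) (hz : ρ ≤ ‖z - w‖) (hz' : ‖z - w‖ ≤ R) :
    ‖radialPush w ρ R z - w‖ = R := by
  have h0 : ‖z - w‖ ≠ 0 := (by linarith : 0 < ‖z - w‖).ne'
  rw [radialPush, max_eq_left hz', max_eq_right hz, add_sub_cancel_left, norm_smul, norm_div,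
    norm_norm, div_mul_cancel₀ _ h0, Real.norm_of_nonneg (by linarith)]

theorem norm_radialPush_sub_self (hρ : 0 < ρ) (hρR : ρ ≤ R) :
    ‖radialPush w ρ R z - z‖ ≤ R := by
  rcases le_total R ‖z - w‖ with h | h
  · rw [radialPush_of_le hρ hρR h, sub_self, norm_zero]
    linarith
  · have hm : 0 < max ρ ‖z - w‖ := lt_max_of_lt_left hρ
    have hq : 1 ≤ R / max ρ ‖z - w‖ := (one_le_div hm).2 (max_le hρR h)
    have : radialPush w ρ R z - z = (R / max ρ ‖z - w‖ - 1) • (z - w) := by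
      rw [radialPush, max_eq_left h, sub_smul, one_smul]
      abel
    rw [this, norm_smul, Real.norm_of_nonneg (by linarith), sub_mul, div_mul_eq_mul_div]
    have : R * ‖z - w‖ / max ρ ‖z - w‖ ≤ R := by
      rw [div_le_iff₀ hm]
      exact mul_le_mul_of_nonneg_left (le_max_right _ _) (by linarith)
    have := norm_nonneg (z - w)
    linarith

theorem lipschitzWith_radialPush (hρ : 0 < ρ) (hρR : ρ ≤ R) (w : V) :
    LipschitzWith (2 * R / ρ).toNNReal (radialPush w ρ R) := by
  set φ : ℝ → ℝ := fun t => max R t / max ρ t with hφ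
  have hm : ∀ t, 0 < max ρ t := fun t => lt_max_of_lt_left hρ
  have hM : ∀ t, 0 < max R t := fun t => lt_max_of_lt_left (by linarith)
  have hφ0 : ∀ t, 0 ≤ φ t := fun t => (div_pos (hM t) (hm t)).le
  have hφR : ∀ t, φ t ≤ R / ρ := by
    intro t
    rw [hφ, div_le_div_iff₀ (hm t) hρ, max_mul_of_nonneg _ _ hρ.le]
    refine max_le ?_ ?_
    · exact mul_le_mul_of_nonneg_left (le_max_left _ _) (by linarith)
    · rcases le_total t 0 with h | h
      · have := mul_pos (by linarith : 0 < R) (hm t)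
        nlinarith
      · rw [mul_comm]
        exact mul_le_mul hρR (le_max_right _ _) h (by linarith)
  have hanti : ∀ a b, a ≤ b → φ b ≤ φ a := by
    intro a b hab
    rw [hφ, div_le_div_iff₀ (hm b) (hm a)]
    rcases le_total b R with h | h
    · rw [max_eq_left h, max_eq_left (hab.trans h)]
      exact mul_le_mul_of_nonneg_left (max_le_max le_rfl hab) (by linarith)
    · rw [max_eq_right h, max_eq_right (hρR.trans h), mul_comm]
      refine mul_le_mul_of_nonneg_right ?_ (by linarith)
      exact max_le_max hρR le_rfl
  have hmono : ∀ a b, 0 ≤ a → a ≤ b → a * φ a ≤ b * φ b := by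
    intro a b ha hab
    rw [hφ, ← mul_div_assoc, ← mul_div_assoc, div_le_div_iff₀ (hm a) (hm b)]
    calc a * max R a * max ρ b = max R a * (a * max ρ b) := by ring
      _ ≤ max R b * (b * max ρ a) := by
          refine mul_le_mul (max_le_max le_rfl hab) ?_ (mul_nonneg ha (hm b).le) (hM b).le
          rw [mul_max_of_nonneg _ _ ha, mul_max_of_nonneg _ _ (ha.trans hab)]
          exact max_le ((mul_le_mul_of_nonneg_right hab hρ.le).trans (le_max_left _ _))
            ((mul_comm a b).le.trans (le_max_right _ _))
      _ = _ := by ring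
  have key : ∀ u v : V, ‖u‖ ≤ ‖v‖ → ‖φ ‖u‖ • u - φ ‖v‖ • v‖ ≤ 2 * R / ρ * ‖u - v‖ := by
    intro u v huv
    have h1 : φ ‖u‖ • u - φ ‖v‖ • v = φ ‖v‖ • (u - v) + (φ ‖u‖ - φ ‖v‖) • u := by
      rw [smul_sub, sub_smul]; abel
    have h2 : (φ ‖u‖ - φ ‖v‖) * ‖u‖ ≤ φ ‖v‖ * ‖u - v‖ := by
      have h3 := hmono _ _ (norm_nonneg u) huv
      have h4 : ‖v‖ - ‖u‖ ≤ ‖u - v‖ := by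
        rw [norm_sub_rev]; exact norm_sub_norm_le _ _
      have h5 := mul_le_mul_of_nonneg_left h4 (hφ0 ‖v‖)
      linarith
    calc ‖φ ‖u‖ • u - φ ‖v‖ • v‖ ≤ φ ‖v‖ * ‖u - v‖ + (φ ‖u‖ - φ ‖v‖) * ‖u‖ := by
          rw [h1]
          refine (norm_add_le _ _).trans_eq ?_
          rw [norm_smul, norm_smul, Real.norm_of_nonneg (hφ0 _),
            Real.norm_of_nonneg (sub_nonneg.2 (hanti _ _ huv))]
      _ ≤ 2 * (φ ‖v‖ * ‖u - v‖) := by linarith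
      _ ≤ 2 * (R / ρ * ‖u - v‖) := by gcongr; exact hφR _
      _ = _ := by ring
  refine LipschitzWith.of_dist_le_mul fun x y => ?_
  rw [Real.coe_toNNReal _ (by have : 0 < R := by linarith
                              positivity), dist_eq_norm, dist_eq_norm]
  have h1 : radialPush w ρ R x - radialPush w ρ R y
      = φ ‖x - w‖ • (x - w) - φ ‖y - w‖ • (y - w) := by
    simp only [radialPush, hφ]; abel
  rw [h1, show x - y = (x - w) - (y - w) by abel]
  rcases le_total ‖x - w‖ ‖y - w‖ with h | h
  · exact key _ _ h
  · rw [norm_sub_rev, norm_sub_rev (x - w)]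
    exact key _ _ h

end RadialPush

section NoRetraction

variable {n : ℕ}

/-- Determinants along a line segment depend polynomially on the parameter. -/
theorem exists_det_interpolation (n : ℕ) {τ : ℝ} (hτ : 0 < τ) :
    ∃ (t : Fin (n + 1) → ℝ) (l : Fin (n + 1) → ℝ), (∀ i, 0 ≤ t i ∧ t i ≤ τ) ∧ ∑ i, l i = 1 ∧
      ∀ B : Matrix (Fin n) (Fin n) ℝ, (1 + B).det = ∑ i, l i * (1 + t i • B).det := by
  set t : Fin (n + 1) → ℝ := fun i => τ * (i / (n + 1 : ℝ)) with ht
  have hinj : InjOn t (Finset.univ : Finset (Fin (n + 1))) := by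
    intro i _ j _ hij
    have h1 := mul_left_cancel₀ hτ.ne' hij
    rw [div_left_inj' (by positivity)] at h1
    exact Fin.ext (by exact_mod_cast h1)
  refine ⟨t, fun i => (Lagrange.basis Finset.univ t i).eval 1,
    fun i => ⟨by positivity, ?_⟩, ?_, ?_⟩
  · refine mul_le_of_le_one_right hτ.le ?_
    rw [div_le_one (by positivity)]
    have : ((i : ℕ) : ℝ) < (n + 1 : ℕ) := by exact_mod_cast i.2
    push_cast at this
    exact this.le
  · simp only
    rw [← Polynomial.eval_finsetSum, Lagrange.sum_basis hinj Finset.univ_nonempty,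
      Polynomial.eval_one]
  · intro B
    set q : Polynomial ℝ :=
      ((Polynomial.X : Polynomial ℝ) • B.map (Polynomial.C : ℝ → Polynomial ℝ)
        + (1 : Matrix (Fin n) (Fin n) ℝ).map (Polynomial.C : ℝ → Polynomial ℝ)).det
    have hq : ∀ s : ℝ, q.eval s = (1 + s • B).det := by
      intro s
      rw [← Polynomial.coe_evalRingHom, show q = Matrix.det _ from rfl, RingHom.map_det]
      congr 1
      ext i j
      rcases eq_or_ne i j with rfl | hij
      · simp [add_comm (1 : ℝ), mul_comm s]
      · simp [hij, mul_comm s]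
    have hdeg : q.degree < (Finset.univ : Finset (Fin (n + 1))).card := by
      have h1 : q.natDegree ≤ n := by
        refine (Polynomial.natDegree_det_X_add_C_le B (1 : Matrix (Fin n) (Fin n) ℝ)).trans_eq ?_
        exact Fintype.card_fin n
      refine (Polynomial.degree_le_of_natDegree_le h1).trans_lt ?_
      simp only [Finset.card_univ, Fintype.card_fin]
      exact_mod_cast Nat.lt_succ_self n
    have h := congrArg (Polynomial.eval 1) (Lagrange.eq_interpolate hinj hdeg)
    rw [hq, one_smul, Lagrange.interpolate_apply, Polynomial.eval_finsetSum] at h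
    rw [h]
    refine Finset.sum_congr rfl fun i _ => ?_
    rw [Polynomial.eval_mul, Polynomial.eval_C, hq, mul_comm]

/-- A Lipschitz map that is the identity outside of a cube cannot map this cube to its boundary. -/
theorem no_lipschitz_retraction (w : Fin n → ℝ) {R : ℝ} (hR : 0 < R) {C : ℝ≥0}
    {F : (Fin n → ℝ) → (Fin n → ℝ)} (hF : LipschitzWith C F)
    (hid : ∀ z, R ≤ ‖z - w‖ → F z = z) :
    ¬ ∀ z, ‖z - w‖ ≤ R → ‖F z - w‖ = R := by
  intro hsph
  set v : (Fin n → ℝ) → (Fin n → ℝ) := fun z => F z - z with hv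
  have hvL : LipschitzWith (C + 1) v := hF.sub LipschitzWith.id
  set L : ℝ := C + 1 with hL
  have hvL' : ∀ x y, ‖v x - v y‖ ≤ L * ‖x - y‖ := fun x y => by
    simpa [dist_eq_norm, hL] using hvL.dist_le_mul x y
  have hLpos : 0 < L := by positivity
  set Q : Set (Fin n → ℝ) := closedBall w R with hQ
  set v' : (Fin n → ℝ) → (Fin n → ℝ) →L[ℝ] (Fin n → ℝ) := fderiv ℝ v
  have hmeas : Measurable v' := measurable_fderiv ℝ v
  have hv'L : ∀ z, ‖v' z‖ ≤ L := fun z => by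
    have := norm_fderiv_le_of_lipschitz ℝ hvL (x₀ := z)
    simpa [hL] using this
  set D : Set (Fin n → ℝ) := {z | DifferentiableAt ℝ v z}
  have hDm : MeasurableSet D := measurableSet_of_differentiableAt ℝ v
  have hDnull : volume Dᶜ = 0 := hvL.ae_differentiableAt
  obtain ⟨δ, hδ, hdet⟩ : ∃ δ > 0, ∀ B : (Fin n → ℝ) →L[ℝ] (Fin n → ℝ), ‖B‖ < δ → 0 < (1 + B).det := by
    have hc : Continuous fun B : (Fin n → ℝ) →L[ℝ] (Fin n → ℝ) => (1 + B).det :=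
      ContinuousLinearMap.continuous_det.comp (continuous_const.add continuous_id)
    have h1 : ∀ᶠ B : (Fin n → ℝ) →L[ℝ] (Fin n → ℝ) in 𝓝 0, 0 < (1 + B).det := by
      refine hc.continuousAt.eventually (lt_mem_nhds ?_)
      simp [ContinuousLinearMap.det]
    obtain ⟨δ, hδ, h⟩ := Metric.eventually_nhds_iff.1 h1
    exact ⟨δ, hδ, fun B hB => h (by simpa using hB)⟩
  set τ : ℝ := min (δ / (2 * L)) (1 / (2 * L))
  have hτ : 0 < τ := by positivity
  have hτ1 : τ * L ≤ 1 / 2 := by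
    calc τ * L ≤ 1 / (2 * L) * L := by gcongr; exact min_le_right _ _
      _ = 1 / 2 := by field_simp
  have hτ2 : τ * L < δ := by
    calc τ * L ≤ δ / (2 * L) * L := by gcongr; exact min_le_left _ _
      _ = δ / 2 := by field_simp
      _ < δ := by linarith
  have hQm : MeasurableSet Q := isClosed_closedBall.measurableSet
  have hQfin : volume Q < ∞ := measure_closedBall_lt_top
  have hbdd : ∀ t : ℝ, Integrable (fun z => (1 + t • v' z).det) (volume.restrict Q) := by
    intro t
    have hm : Measurable fun z => (1 + t • v' z).det :=
      ContinuousLinearMap.continuous_det.measurable.comp (measurable_const.add (hmeas.const_smul t))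
    obtain ⟨M, hM⟩ : ∃ M, ∀ B ∈ closedBall (0 : (Fin n → ℝ) →L[ℝ] (Fin n → ℝ)) L, ‖(1 + t • B).det‖ ≤ M :=
      (isCompact_closedBall _ _).exists_bound_of_continuousOn
        (ContinuousLinearMap.continuous_det.comp
          (continuous_const.add (continuous_const_smul t))).continuousOn
    have : IsFiniteMeasure (volume.restrict Q) := ⟨by simpa using hQfin⟩
    exact Integrable.of_bound hm.aestronglyMeasurable M
      (Eventually.of_forall fun z => hM _ (by simpa using hv'L z))
  have hsmall : ∀ t : ℝ, 0 ≤ t → t ≤ τ →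
      ∫ z in Q, (1 + t • v' z).det = (volume Q).toReal := by
    intro t ht0 htτ
    have htL : t * L ≤ 1 / 2 := (mul_le_mul_of_nonneg_right htτ hLpos.le).trans hτ1
    set G : (Fin n → ℝ) → (Fin n → ℝ) := fun z => z + t • v z with hG
    have hGinj : Function.Injective G := by
      intro x y hxy
      have h1 : x - y = t • (v y - v x) := by
        have : x + t • v x = y + t • v y := hxy
        rw [smul_sub, sub_eq_sub_iff_add_eq_add, this]; abel
      have h2 : ‖x - y‖ ≤ 1 / 2 * ‖x - y‖ := by
        calc ‖x - y‖ = t * ‖v y - v x‖ := by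
              rw [h1, norm_smul, Real.norm_of_nonneg ht0]
          _ ≤ t * (L * ‖x - y‖) := by
              rw [norm_sub_rev x y]; gcongr; exact hvL' _ _
          _ = t * L * ‖x - y‖ := by ring
          _ ≤ _ := by gcongr
      have h3 : ‖x - y‖ = 0 := by linarith [norm_nonneg (x - y)]
      exact sub_eq_zero.1 (norm_eq_zero.1 h3)
    have hGsurj : Function.Surjective G := by
      intro y
      have hcon : ContractingWith (1 / 2 : ℝ≥0) fun z => y - t • v z := by
        refine ⟨by rw [← NNReal.coe_lt_coe]; norm_num, LipschitzWith.of_dist_le_mul fun a b => ?_⟩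
        rw [dist_eq_norm, dist_eq_norm]
        calc ‖y - t • v a - (y - t • v b)‖ = t * ‖v b - v a‖ := by
              rw [sub_sub_sub_cancel_left, ← smul_sub, norm_smul, Real.norm_of_nonneg ht0]
          _ ≤ t * (L * ‖a - b‖) := by
              rw [norm_sub_rev a b]; gcongr; exact hvL' _ _
          _ = t * L * ‖a - b‖ := by ring
          _ ≤ _ := by
              push_cast
              gcongr
      have := hcon.fixedPoint_isFixedPt
      refine ⟨ContractingWith.fixedPoint _ hcon, ?_⟩
      simp only [Function.IsFixedPt] at this
      simp only [hG]
      nth_rw 1 [← this]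
      abel
    have hGid : ∀ z, z ∉ Q → G z = z := by
      intro z hz
      have : R ≤ ‖z - w‖ := by
        rw [hQ, mem_closedBall, dist_eq_norm, not_le] at hz
        exact hz.le
      simp [hG, hv, hid z this]
    have hGQ : G '' Q = Q := by
      apply Subset.antisymm
      · rintro _ ⟨z, hz, rfl⟩
        by_contra h
        exact h (by rwa [hGinj (hGid _ h)])
      · intro y hy
        obtain ⟨z, rfl⟩ := hGsurj y
        by_contra h
        have hz : z ∉ Q := fun hz => h ⟨z, hz, rfl⟩
        exact hz (by rwa [hGid z hz] at hy)
    have hGL : LipschitzWith (1 + (t.toNNReal * (C + 1))) G := by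
      refine LipschitzWith.id.add ?_
      have := (lipschitzWith_smul t (α := ℝ) (β := (Fin n → ℝ))).comp hvL
      rw [show ‖t‖₊ = t.toNNReal from (Real.toNNReal_eq_nnnorm_of_nonneg ht0).symm] at this
      exact this
    have hGnull : volume (G '' Dᶜ) = 0 := by
      have h1 := (hGL.lipschitzOnWith (s := Dᶜ)).hausdorffMeasure_image_le
        (d := (Fintype.card (Fin n) : ℝ)) (by positivity)
      rw [hausdorffMeasure_pi_real, hDnull, mul_zero] at h1
      exact le_antisymm h1 (zero_le)
    have hvol : volume (G '' (Q ∩ D)) = volume Q := by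
      refine le_antisymm ((measure_mono (image_mono inter_subset_left)).trans (measure_mono hGQ.subset)) ?_
      calc volume Q = volume (G '' Q) := by rw [hGQ]
        _ ≤ volume (G '' (Q ∩ D) ∪ G '' Dᶜ) := by
            rw [← image_union]
            refine measure_mono (image_mono fun z hz => ?_)
            by_cases hzD : z ∈ D
            · exact Or.inl ⟨hz, hzD⟩
            · exact Or.inr hzD
        _ ≤ volume (G '' (Q ∩ D)) + 0 := by
            rw [← hGnull]; exact measure_union_le _ _
        _ = _ := add_zero _
    have hpos : ∀ z, 0 < (1 + t • v' z).det := fun z => hdet _ <| by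
      calc ‖t • v' z‖ = t * ‖v' z‖ := by rw [norm_smul, Real.norm_of_nonneg ht0]
        _ ≤ τ * L := by gcongr; exact hv'L z
        _ < δ := hτ2
    have hcv := lintegral_abs_det_fderiv_eq_addHaar_image (volume : Measure (Fin n → ℝ)) (f := G)
      (f' := fun z => 1 + t • v' z) (hQm.inter hDm)
      (fun z hz => by
        have h1 : HasFDerivAt v (v' z) z := DifferentiableAt.hasFDerivAt hz.2
        exact ((hasFDerivAt_id z).add (h1.const_smul t)).hasFDerivWithinAt) hGinj.injOn
    rw [hvol] at hcv
    have hae : (volume.restrict (Q ∩ D)) = volume.restrict Q := by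
      refine Measure.restrict_congr_set ?_
      have : ∀ᵐ z ∂(volume : Measure (Fin n → ℝ)), z ∈ D := hDnull
      filter_upwards [this] with z hz
      exact propext ⟨fun h => h.1, fun h => ⟨h, hz⟩⟩
    rw [hae] at hcv
    rw [integral_eq_lintegral_of_nonneg_ae (Eventually.of_forall fun z => (hpos z).le)
      (hbdd t).aestronglyMeasurable, ← hcv]
    congr 1
    refine lintegral_congr fun z => ?_
    rw [abs_of_pos (hpos z)]
  obtain ⟨t, l, ht, hl, hpoly⟩ := exists_det_interpolation n hτ
  have hpoly' : ∀ B : (Fin n → ℝ) →L[ℝ] (Fin n → ℝ), (1 + B).det = ∑ i, l i * (1 + t i • B).det := by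
    intro B
    have h1 : ∀ s : ℝ, (1 + s • B).det = (1 + s • LinearMap.toMatrix' (B : (Fin n → ℝ) →ₗ[ℝ] (Fin n → ℝ))).det := by
      intro s
      rw [ContinuousLinearMap.det, ← LinearMap.det_toMatrix']
      congr 1
      rw [ContinuousLinearMap.toLinearMap_add, map_add, ContinuousLinearMap.toLinearMap_smul, map_smul]
      congr 1
      exact LinearMap.toMatrix'_one
    have := hpoly (LinearMap.toMatrix' (B : (Fin n → ℝ) →ₗ[ℝ] (Fin n → ℝ)))
    simp only [← h1] at this
    rw [← this]
    have h2 := h1 1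
    rwa [one_smul, one_smul] at h2
  have hone : ∫ z in Q, (1 + v' z).det = (volume Q).toReal := by
    rw [show (fun z => (1 + v' z).det) = fun z => ∑ i, l i * (1 + t i • v' z).det from
        funext fun z => hpoly' (v' z),
      integral_finsetSum _ fun i _ => (hbdd (t i)).const_mul (l i)]
    simp_rw [integral_const_mul]
    rw [Finset.sum_congr rfl fun i _ => by rw [hsmall (t i) (ht i).1 (ht i).2],
      ← Finset.sum_mul, hl, one_mul]
  have hzero : ∀ z ∈ ball w R, z ∈ D → (1 + v' z).det = 0 := by
    intro z hz hzD
    have hFd : HasFDerivAt F (1 + v' z) z := by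
      have h1 : HasFDerivAt v (v' z) z := DifferentiableAt.hasFDerivAt hzD
      have h2 := (hasFDerivAt_id (𝕜 := ℝ) z).add h1
      refine h2.congr_of_eventuallyEq (Eventually.of_forall fun y => ?_)
      simp [hv]
    have hle : ∀ y ∈ ball w R, ‖F y - w‖ = R := fun y hy => hsph y (by
      rw [← dist_eq_norm]; exact (mem_ball.1 hy).le)
    obtain ⟨i, hi⟩ : ∃ i, ‖(F z - w) i‖ = R := by
      by_contra! h
      have : ‖F z - w‖ < R := (pi_norm_lt_iff hR).2 fun i =>
        lt_of_le_of_ne ((norm_le_pi_norm _ i).trans (hle z hz).le) (h i)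
      exact this.ne (hle z hz)
    have hFi : HasFDerivAt (fun y => F y i) ((ContinuousLinearMap.proj i).comp (1 + v' z)) z :=
      ((ContinuousLinearMap.proj (R := ℝ) (φ := fun _ : Fin n => ℝ) i).hasFDerivAt).comp z hFd
    have hbd : ∀ y ∈ ball w R, |F y i - w i| ≤ R := fun y hy =>
      (norm_le_pi_norm (F y - w) i).trans (hle y hy).le
    have hnhds : ball w R ∈ 𝓝 z := isOpen_ball.mem_nhds hz
    have hext : IsLocalExtr (fun y => F y i) z := by
      have hi' : |F z i - w i| = R := hi
      rcases abs_cases (F z i - w i) with ⟨h, -⟩ | ⟨h, -⟩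
      · refine Or.inr ?_
        filter_upwards [hnhds] with y hy
        have := (abs_le.1 (hbd y hy)).2
        linarith
      · refine Or.inl ?_
        filter_upwards [hnhds] with y hy
        have := (abs_le.1 (hbd y hy)).1
        linarith
    have h0 := hext.hasFDerivAt_eq_zero hFi
    by_contra hne
    obtain ⟨u, hu⟩ := (LinearEquiv.ofIsUnitDet (f := ((1 + v' z : (Fin n → ℝ) →L[ℝ] (Fin n → ℝ)) :
        (Fin n → ℝ) →ₗ[ℝ] (Fin n → ℝ))) (v := Pi.basisFun ℝ (Fin n)) (v' := Pi.basisFun ℝ (Fin n))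
        (by rw [LinearMap.det_toMatrix]; exact isUnit_iff_ne_zero.2 hne)).surjective
      (Pi.single i 1)
    have h2 := congrArg (fun T : (Fin n → ℝ) →L[ℝ] ℝ => T u) h0
    simp only [ContinuousLinearMap.comp_apply, ContinuousLinearMap.proj_apply,
      zero_apply] at h2
    have h3 : ((1 + v' z) u) i = 1 := by
      have := congrFun hu i
      simpa using this
    rw [h3] at h2
    exact one_ne_zero h2
  have hQ0 : (volume Q).toReal = 0 := by
    rw [← hone, ← integral_zero ((Fin n → ℝ)) ℝ (μ := volume.restrict Q)]
    refine integral_congr_ae ?_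
    have h1 : ∀ᵐ z ∂(volume : Measure (Fin n → ℝ)), z ∈ D := hDnull
    have h2 : ∀ᵐ z ∂(volume : Measure (Fin n → ℝ)), z ∉ sphere w R :=
      measure_eq_zero_iff_ae_notMem.1 (Measure.addHaar_sphere_of_ne_zero _ w hR.ne')
    filter_upwards [ae_restrict_of_ae h1, ae_restrict_of_ae h2, ae_restrict_mem hQm]
      with z hz1 hz2 hz3
    exact hzero z (mem_ball.2 (lt_of_le_of_ne (mem_closedBall.1 hz3) hz2)) hz1
  exact (ENNReal.toReal_pos (measure_closedBall_pos volume w hR).ne' hQfin.ne).ne' hQ0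

end NoRetraction

section Approximation

variable {Q X ι : Type*} [TopologicalSpace Q] [CompactSpace Q] [Fintype ι]

theorem exists_lipschitzWith_pi [PseudoMetricSpace X] {f : X → ι → ℝ}
    (hf : ∀ i, ∃ C, LipschitzWith C fun x => f x i) : ∃ C, LipschitzWith C f := by
  choose C hC using hf
  refine ⟨∑ i, C i, LipschitzWith.of_dist_le_mul fun x y => ?_⟩
  refine (dist_pi_le_iff (by positivity)).2 fun i => ((hC i).dist_le_mul x y).trans ?_
  gcongr
  exact_mod_cast Finset.single_le_sum (f := C) (fun _ _ => zero_le) (Finset.mem_univ i)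

theorem exists_lipschitz_approx_real [MetricSpace X] {ψ : Q → X} (hψ : Continuous ψ)
    (hinj : Function.Injective ψ) {h : Q → ℝ} (hh : Continuous h) {ε : ℝ} (hε : 0 < ε) :
    ∃ (C : ℝ≥0) (f : X → ℝ), LipschitzWith C f ∧ ∀ q, |f (ψ q) - h q| ≤ ε := by
  rcases isEmpty_or_nonempty Q with hQ | hQ
  · exact ⟨0, fun _ => 0, LipschitzWith.const 0, fun q => hQ.elim q⟩
  obtain ⟨δ, hδ, hδD⟩ : ∃ δ > 0, ∀ p ∈ {p : Q × Q | ε ≤ h p.1 - h p.2},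
      δ ≤ dist (ψ p.1) (ψ p.2) := by
    refine (IsClosed.isCompact (isClosed_le continuous_const (by fun_prop))).exists_forall_le'
      (by fun_prop) fun p hp => dist_pos.2 fun heq => ?_
    have hp' : ε ≤ h p.1 - h p.2 := hp
    rw [hinj heq, sub_self] at hp'
    exact hp'.not_gt hε
  obtain ⟨M, hM⟩ := isCompact_univ.exists_bound_of_continuousOn hh.continuousOn (s := univ)
  have hM' : ∀ q, |h q| ≤ M := fun q => hM q (mem_univ q)
  have hM0 : 0 ≤ M := (abs_nonneg _).trans (hM' hQ.some)
  set N : ℝ := 2 * M / δ with hN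
  have hN0 : 0 ≤ N := by positivity
  set f : X → ℝ := fun x => ⨅ q, (h q + N * dist x (ψ q)) with hf
  have hbdd : ∀ x, BddBelow (range fun q => h q + N * dist x (ψ q)) := by
    refine fun x => ⟨-M, ?_⟩
    rintro _ ⟨q, rfl⟩
    have h1 := (abs_le.1 (hM' q)).1
    have h2 : 0 ≤ N * dist x (ψ q) := by positivity
    simp only
    linarith
  refine ⟨N.toNNReal, f, LipschitzWith.of_le_add_mul' N fun x y => ?_, fun q => abs_le.2 ⟨?_, ?_⟩⟩
  · rw [← sub_le_iff_le_add]
    refine le_ciInf fun q => ?_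
    have h1 : f x ≤ h q + N * dist x (ψ q) := ciInf_le (hbdd x) q
    have h2 := mul_le_mul_of_nonneg_left (dist_triangle x y (ψ q)) hN0
    linarith
  · suffices h q - ε ≤ f (ψ q) by linarith
    refine le_ciInf fun q' => ?_
    rcases le_total ε (h q - h q') with hq | hq
    · have h1 := mul_le_mul_of_nonneg_left (hδD (q, q') hq) hN0
      have h2 : N * δ = 2 * M := by rw [hN]; field_simp
      have h3 := (abs_le.1 (hM' q)).2
      have h4 := (abs_le.1 (hM' q')).1
      simp only at h1
      linarith
    · have : 0 ≤ N * dist (ψ q) (ψ q') := by positivity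
      linarith
  · have h1 : f (ψ q) ≤ h q + N * dist (ψ q) (ψ q) := ciInf_le (hbdd _) q
    rw [dist_self, mul_zero] at h1
    linarith

/-- A continuous map on a compact set can be approximated by Lipschitz maps. -/
theorem exists_lipschitz_approx [MetricSpace X] {ψ : Q → X} (hψ : Continuous ψ)
    (hinj : Function.Injective ψ) {h : Q → ι → ℝ} (hh : Continuous h) {ε : ℝ} (hε : 0 < ε) :
    ∃ (C : ℝ≥0) (f : X → ι → ℝ), LipschitzWith C f ∧ ∀ q, ‖f (ψ q) - h q‖ ≤ ε := by
  choose C f hf hfh using fun i => exists_lipschitz_approx_real hψ hinj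
    ((continuous_apply i).comp hh) hε
  obtain ⟨C', hC'⟩ := exists_lipschitzWith_pi (f := fun x i => f i x) fun i => ⟨C i, hf i⟩
  exact ⟨C', fun x i => f i x, hC', fun q => (pi_norm_le_iff_of_nonneg hε.le).2 fun i => hfh i q⟩

/-- A continuous map that moves points of the unit cube by at most `1 / 4` covers the cube of
radius `1 / 4`. -/
theorem ball_subset_range_of_norm_sub_le {n : ℕ}
    {h : closedBall (0 : Fin n → ℝ) 1 → (Fin n → ℝ)} (hh : Continuous h)
    (hid : ∀ z, ‖h z - z‖ ≤ 1 / 4) : ball 0 (1 / 4) ⊆ range h := by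
  intro w hw
  rw [mem_ball_zero_iff] at hw
  by_contra hwr
  have : CompactSpace (closedBall (0 : Fin n → ℝ) 1) :=
    isCompact_iff_compactSpace.1 (isCompact_closedBall _ _)
  obtain ⟨s', hs', hsub⟩ := Metric.isOpen_iff.1 (isCompact_range hh).isClosed.isOpen_compl w hwr
  set s : ℝ := min (s' / 2) (1 / 8)
  have hs : 0 < s := by positivity
  have hs8 : s ≤ 1 / 8 := min_le_right _ _
  have hs2 : 2 * s ≤ s' := by linarith [min_le_left (s' / 2) (1 / 8)]
  have havoid : ∀ z, 2 * s ≤ ‖h z - w‖ := by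
    intro z
    by_contra! hz
    exact hsub (mem_ball_iff_norm.2 (hz.trans_le hs2)) ⟨z, rfl⟩
  obtain ⟨C, f, hf, hfh⟩ := exists_lipschitz_approx continuous_subtype_val
    Subtype.val_injective hh hs
  set c : (Fin n → ℝ) → ℝ := fun z => max 0 (3 / 2 * (1 - ‖z‖)) with hc
  have hc0 : ∀ z, 0 ≤ c z := fun z => le_max_left _ _
  have hcL : LipschitzWith (3 / 2) c := by
    refine LipschitzWith.const_max (LipschitzWith.of_dist_le_mul fun x y => ?_) 0
    rw [Real.dist_eq, ← mul_sub, abs_mul, sub_sub_sub_cancel_left, dist_eq_norm, norm_sub_rev,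
      abs_of_pos (by norm_num : (0 : ℝ) < 3 / 2)]
    push_cast
    gcongr
    exact abs_norm_sub_norm_le _ _
  set H : (Fin n → ℝ) → Fin n → ℝ :=
    fun z i => z i + max (-c z) (min (c z) (f z i - z i)) with hH
  obtain ⟨C', hHL⟩ : ∃ C', LipschitzWith C' H := by
    refine exists_lipschitzWith_pi fun i => ⟨_, (LipschitzWith.eval i).add
      (hcL.neg.max (hcL.min ((LipschitzWith.comp (LipschitzWith.eval i) hf).sub
        (LipschitzWith.eval i))))⟩
  have hHc : ∀ z, ‖H z - z‖ ≤ c z := by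
    intro z
    refine (pi_norm_le_iff_of_nonneg (hc0 z)).2 fun i => ?_
    rw [Pi.sub_apply, hH, add_sub_cancel_left, Real.norm_eq_abs, abs_le]
    exact ⟨le_max_left _ _, max_le (by linarith [hc0 z]) (min_le_left _ _)⟩
  have hHid : ∀ z, 1 ≤ ‖z‖ → H z = z := by
    intro z hz
    have h1 : c z = 0 := max_eq_left (by linarith)
    have h2 := hHc z
    rw [h1] at h2
    exact sub_eq_zero.1 (norm_le_zero_iff.1 h2)
  have hHs : ∀ z, s ≤ ‖H z - w‖ := by
    intro z
    have hzw : ‖z‖ ≤ ‖H z - w‖ + ‖H z - z‖ + ‖w‖ := by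
      calc ‖z‖ = ‖(H z - w) - (H z - z) + w‖ := by congr 1; abel
        _ ≤ _ := (norm_add_le _ _).trans (by gcongr; exact norm_sub_le _ _)
    rcases le_total 1 ‖z‖ with h1 | h1
    · rw [hHid z h1, sub_self, norm_zero] at hzw
      rw [hHid z h1]
      linarith
    · have hcz : c z = 3 / 2 * (1 - ‖z‖) := max_eq_right (by linarith)
      rcases le_total (3 / 4) ‖z‖ with h2 | h2
      · have := hHc z
        linarith
      · set q : closedBall (0 : Fin n → ℝ) 1 := ⟨z, mem_closedBall_zero_iff.2 h1⟩
        have h3 : ‖f z - h q‖ ≤ s := hfh q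
        have h4 : ‖f z - z‖ ≤ c z := by
          have h5 : ‖h q - z‖ ≤ 1 / 4 := hid q
          have := norm_sub_le_norm_sub_add_norm_sub (f z) (h q) z
          linarith
        have h5 : H z = f z := by
          funext i
          have h6 := abs_le.1 ((norm_le_pi_norm (f z - z) i).trans h4)
          rw [Pi.sub_apply] at h6
          rw [hH]
          simp only
          rw [min_eq_right h6.2, max_eq_right h6.1]
          ring
        rw [h5]
        have h6 := norm_sub_le_norm_sub_add_norm_sub (h q) (f z) w
        rw [norm_sub_rev (h q) (f z)] at h6
        linarith [havoid q]
  have hH2 : ∀ z, ‖z - w‖ ≤ 2 → ‖H z - w‖ ≤ 2 := by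
    intro z hz
    rcases le_total 1 ‖z‖ with h1 | h1
    · rwa [hHid z h1]
    · have h2 := hHc z
      have hcz : c z = 3 / 2 * (1 - ‖z‖) := max_eq_right (by linarith)
      have h3 : ‖H z - w‖ ≤ ‖H z - z‖ + (‖z‖ + ‖w‖) :=
        (norm_sub_le_norm_sub_add_norm_sub _ z _).trans (by gcongr; exact norm_sub_le _ _)
      have := norm_nonneg z
      linarith
  refine no_lipschitz_retraction w two_pos
    ((lipschitzWith_radialPush hs (by linarith : s ≤ 2) w).comp hHL) (fun z hz => ?_)
    fun z hz => norm_radialPush_sub hs (by linarith) (hHs z) (hH2 z hz)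
  have h1 : 1 ≤ ‖z‖ := by linarith [norm_sub_le z w]
  rw [Function.comp_apply, hHid z h1, radialPush_of_le hs (by linarith) hz]

end Approximation

section Injective

variable {X : Type*} [MetricSpace X] [CompactSpace X] {n : ℕ}

theorem exists_isClosed_lt_volume_image_separated {f : X → Fin n → ℝ} (hf : Continuous f)
    {M U V : Set X} (hM : IsClosed M) (hU : IsClosed U) (hV : IsClosed V) (hUV : Disjoint U V)
    {c : ℝ≥0∞} (hc : c < volume (f '' M)) :
    ∃ M' ⊆ M, IsClosed M' ∧ c < volume (f '' M') ∧
      ∀ x ∈ M' ∩ U, ∀ y ∈ M' ∩ V, f x ≠ f y := by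
  have hcl : IsClosed (U ∩ f ⁻¹' (f '' (M ∩ V))) :=
    hU.inter (((hM.inter hV).isCompact.image hf).isClosed.preimage hf)
  obtain ⟨F, hFc, -, hFU, hFm⟩ := hcl.isOpen_compl.exists_iUnion_isClosed
  have himage : ⋃ j, f '' (M ∩ F j) = f '' M := by
    rw [← image_iUnion, ← inter_iUnion, hFU]
    refine Subset.antisymm (image_mono inter_subset_left) ?_
    rintro _ ⟨x, hx, rfl⟩
    by_cases hxV : f x ∈ f '' (M ∩ V)
    · obtain ⟨y, hy, hyx⟩ := hxV
      exact ⟨y, ⟨hy.1, fun h => disjoint_left.1 hUV h.1 hy.2⟩, hyx⟩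
    · exact ⟨x, ⟨hx, fun h => hxV h.2⟩, rfl⟩
  have hmono : Monotone fun j => f '' (M ∩ F j) :=
    fun i j hij => image_mono (inter_subset_inter_right _ (hFm hij))
  rw [← himage, hmono.measure_iUnion, lt_iSup_iff] at hc
  obtain ⟨j, hj⟩ := hc
  refine ⟨M ∩ F j, inter_subset_left, hM.inter (hFc j), hj, fun x hx y hy hxy => ?_⟩
  have hxF : x ∈ (U ∩ f ⁻¹' (f '' (M ∩ V)))ᶜ := hFU ▸ mem_iUnion_of_mem j hx.1.2
  exact hxF ⟨hx.2, y, ⟨hy.1.1, hy.2⟩, hxy.symm⟩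

/-- A compact set with an image of positive volume contains a compact set with the same property
on which the map is injective. -/
theorem exists_isClosed_injOn {f : X → Fin n → ℝ} (hf : Continuous f)
    {M : Set X} (hM : IsClosed M) (hpos : 0 < volume (f '' M)) :
    ∃ P ⊆ M, IsClosed P ∧ InjOn f P ∧ 0 < volume (f '' P) := by
  have : Nonempty X := by
    rcases M.eq_empty_or_nonempty with rfl | ⟨x, -⟩
    · simp at hpos
    · exact ⟨x⟩
  obtain ⟨c, hc0, hc⟩ := exists_between hpos
  set D : ℕ × ℕ → Set X := fun p => closedBall (TopologicalSpace.denseSeq X p.1) (1 / (p.2 + 1))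
  have hD : ∀ p, IsClosed (D p) := fun p => isClosed_closedBall
  have step : ∀ (i : ℕ) (N : {N : Set X // IsClosed N ∧ c < volume (f '' N)}),
      ∃ N' : {N : Set X // IsClosed N ∧ c < volume (f '' N)}, N'.1 ⊆ N.1 ∧
        ∀ p, (Denumerable.eqv ((ℕ × ℕ) × (ℕ × ℕ))).symm i = p → Disjoint (D p.1) (D p.2) →
          ∀ x ∈ N'.1 ∩ D p.1, ∀ y ∈ N'.1 ∩ D p.2, f x ≠ f y := by
    rintro i ⟨N, hN, hcN⟩
    set p := (Denumerable.eqv ((ℕ × ℕ) × (ℕ × ℕ))).symm i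
    by_cases hp : Disjoint (D p.1) (D p.2)
    · obtain ⟨N', h1, h2, h3, h4⟩ :=
        exists_isClosed_lt_volume_image_separated hf hN (hD p.1) (hD p.2) hp hcN
      refine ⟨⟨N', h2, h3⟩, h1, ?_⟩
      rintro _ rfl _
      exact h4
    · refine ⟨⟨N, hN, hcN⟩, Subset.rfl, ?_⟩
      rintro _ rfl h
      exact absurd h hp
  choose g hgsub hgsep using step
  set N : ℕ → {N : Set X // IsClosed N ∧ c < volume (f '' N)} :=
    fun i => Nat.rec ⟨M, hM, hc⟩ g i with hN
  have hNsucc : ∀ i, N (i + 1) = g i (N i) := fun i => rfl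
  have hanti : Antitone fun i => (N i).1 := antitone_nat_of_succ_le fun i => hgsub i (N i)
  have hPc : IsClosed (⋂ i, (N i).1) := isClosed_iInter fun i => (N i).2.1
  refine ⟨⋂ i, (N i).1, iInter_subset _ 0, hPc, ?_, ?_⟩
  · intro x hx y hy hxy
    by_contra hne
    have hd : 0 < dist x y := dist_pos.2 hne
    obtain ⟨b, hb⟩ := exists_nat_one_div_lt (by positivity : 0 < dist x y / 4)
    have hb0 : (0 : ℝ) < 1 / (b + 1) := by positivity
    have hdense := TopologicalSpace.denseRange_denseSeq X
    obtain ⟨a, ha⟩ := hdense.exists_dist_lt x hb0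
    obtain ⟨a', ha'⟩ := hdense.exists_dist_lt y hb0
    have hdisj : Disjoint (D (a, b)) (D (a', b)) := by
      refine disjoint_left.2 fun z hz hz' => ?_
      have h1 : dist z _ ≤ 1 / ((b : ℝ) + 1) := hz
      have h2 : dist z _ ≤ 1 / ((b : ℝ) + 1) := hz'
      have h3 := dist_triangle4 x (TopologicalSpace.denseSeq X a) z y
      have h4 := dist_triangle_right z y (TopologicalSpace.denseSeq X a')
      rw [dist_comm _ z] at h3
      simp only at h1 h2
      linarith
    set i := Denumerable.eqv ((ℕ × ℕ) × (ℕ × ℕ)) ((a, b), (a', b))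
    exact hgsep i (N i) ((a, b), (a', b)) ((Denumerable.eqv _).symm_apply_apply _) hdisj
      x ⟨mem_iInter.1 hx (i + 1), ha.le⟩ y ⟨mem_iInter.1 hy (i + 1), ha'.le⟩ hxy
  · have himage : ⋂ i, f '' (N i).1 ⊆ f '' ⋂ i, (N i).1 := by
      intro y hy
      obtain ⟨x, hx⟩ := IsCompact.nonempty_iInter_of_sequence_nonempty_isCompact_isClosed
        (fun i => (N i).1 ∩ f ⁻¹' {y}) (fun i => inter_subset_inter_left _ (hanti i.le_succ))
        (fun i => by
          obtain ⟨x, hx, hxy⟩ := mem_iInter.1 hy i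
          exact ⟨x, hx, hxy⟩)
        ((N 0).2.1.inter (isClosed_singleton.preimage hf)).isCompact
        fun i => (N i).2.1.inter (isClosed_singleton.preimage hf)
      exact ⟨x, mem_iInter.2 fun i => (mem_iInter.1 hx i).1, (mem_iInter.1 hx 0).2⟩
    refine lt_of_lt_of_le hc0 (le_trans ?_ (measure_mono himage))
    have hcomp : ∀ i, IsCompact (f '' (N i).1) := fun i => (N i).2.1.isCompact.image hf
    rw [Antitone.measure_iInter (fun i j hij => image_mono (hanti hij))
      (fun i => (hcomp i).isClosed.measurableSet.nullMeasurableSet)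
      ⟨0, (hcomp 0).measure_lt_top.ne⟩]
    exact le_iInf fun i => (N i).2.2.le

end Injective

section DensePoints

variable {X : Type*} [MetricSpace X] {n : ℕ}

/-- The points `x` of `A` such that, at all scales below `r₀`, the image of `A` near `x` is almost
dense in a ball around `f x`. -/
def densePoints (f : X → Fin n → ℝ) (A : Set X) (θ r₀ : ℝ) : Set X :=
  {x ∈ A | ∀ r, 0 < r → r < r₀ → ∀ w, ‖w - f x‖ < θ * r →
    ∃ y ∈ A, dist y x ≤ r ∧ ‖f y - w‖ ≤ θ * r / 8}

theorem densePoints_subset {f : X → Fin n → ℝ} {A : Set X} {θ r₀ : ℝ} :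
    densePoints f A θ r₀ ⊆ A := fun _ hx => hx.1

theorem isClosed_densePoints [CompactSpace X] {f : X → Fin n → ℝ} (hf : Continuous f) {A : Set X}
    (hA : IsClosed A) (θ r₀ : ℝ) : IsClosed (densePoints f A θ r₀) := by
  have h : densePoints f A θ r₀ = A ∩ ⋂ (r : ℝ) (_ : 0 < r) (_ : r < r₀) (w : Fin n → ℝ),
      {x | θ * r ≤ ‖w - f x‖} ∪
        Prod.snd '' {p : X × X | p.1 ∈ A ∧ dist p.1 p.2 ≤ r ∧ ‖f p.1 - w‖ ≤ θ * r / 8} := by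
    ext x
    simp only [densePoints, mem_ofPred_eq, mem_inter_iff, mem_iInter, mem_union, mem_image,
      Prod.exists, exists_eq_right, ← not_lt, or_iff_not_imp_left, not_not]
  rw [h]
  have h1 : ∀ r w, IsClosed {x | θ * r ≤ ‖w - f x‖} := fun r w =>
    isClosed_le (by fun_prop) (by fun_prop)
  have h2 : ∀ r w, IsClosed {p : X × X | p.1 ∈ A ∧ dist p.1 p.2 ≤ r ∧ ‖f p.1 - w‖ ≤ θ * r / 8} := by
    intro r w
    have h3 : IsClosed {p : X × X | dist p.1 p.2 ≤ r} := isClosed_le (by fun_prop) (by fun_prop)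
    have h4 : IsClosed {p : X × X | ‖f p.1 - w‖ ≤ θ * r / 8} :=
      isClosed_le (by fun_prop) (by fun_prop)
    exact (hA.preimage continuous_fst).inter (h3.inter h4)
  exact hA.inter (isClosed_iInter fun r => isClosed_iInter fun _ => isClosed_iInter fun _ =>
    isClosed_iInter fun w => (h1 r w).union (isClosedMap_snd_of_compactSpace _ (h2 r w)))

end DensePoints

section NullImage

variable {X : Type*} [MetricSpace X] [MeasurableSpace X] [BorelSpace X] {n : ℕ}

theorem volume_image_le {C : ℝ≥0} {f : X → Fin n → ℝ} (hf : LipschitzWith C f) (S : Set X) :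
    volume (f '' S) ≤ (C : ℝ≥0∞) ^ n * μH[n] S := by
  have h := hf.hausdorffMeasure_image_le (d := (n : ℝ)) (by positivity) S
  have h2 : (μH[(n : ℝ)] : Measure (Fin n → ℝ)) = volume := by
    rw [← hausdorffMeasure_pi_real, Fintype.card_fin]
  rwa [h2, ENNReal.rpow_natCast] at h

variable [CompactSpace X]

variable {k θ r₀ : ℝ} {A P : Set X} {L : ℝ≥0} {f : X → Fin n → ℝ}

/-- Near a dense point of `P`, the part of a ball not covered by the image of `P` is controlled
by the measure of the complement of `P`. -/
theorem volume_ball_diff_image_le (hk : 1 ≤ k) (hAk : A ⊆ regularPoints X n k)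
    (hf : LipschitzWith L f) (hL : 1 ≤ L) (hθ : 0 < θ) (hθ1 : θ ≤ 1) (hP : IsClosed P)
    (hPA : P ⊆ densePoints f A θ r₀) {x : X} (hx : x ∈ P) {r : ℝ} (hr : 0 < r) (hr₀ : r < r₀)
    (hrk : r < 1 / k) :
    volume (ball (f x) (θ / 8 * r) \ f '' (P ∩ closedBall x r)) ≤
      ENNReal.ofReal ((40 * L) ^ n * k) * μH[n] (closedBall x (3 * r) \ P) := by
  have hL' : (1 : ℝ) ≤ L := by exact_mod_cast hL
  set E := ball (f x) (θ / 8 * r) \ f '' (P ∩ closedBall x r) with hE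
  have key : ∀ z ∈ E, ∃ ρ y, 0 < ρ ∧ ρ ≤ θ / 8 * r ∧ y ∈ A ∧
      closedBall y (ρ / (4 * L)) ⊆ f ⁻¹' closedBall z ρ ∩ (closedBall x (3 * r) \ P) := by
    intro z hz
    obtain ⟨y₀, hy₀, hmin⟩ := hP.isCompact.exists_isMinOn ⟨x, hx⟩
      (f := fun y => ‖z - f y‖ + θ / 8 * dist x y) (by
        have := hf.continuous
        fun_prop)
    have hmin' : ∀ y ∈ P, ‖z - f y₀‖ + θ / 8 * dist x y₀ ≤ ‖z - f y‖ + θ / 8 * dist x y :=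
      fun y hy => hmin hy
    have hzx : ‖z - f x‖ < θ / 8 * r := by rw [← dist_eq_norm]; exact hz.1
    have h0 := hmin' x hx
    rw [dist_self, mul_zero, add_zero] at h0
    have hd0 : 0 ≤ θ / 8 * dist x y₀ := by positivity
    have hdr : dist x y₀ < r := by
      by_contra! h
      have h1 : θ / 8 * r ≤ θ / 8 * dist x y₀ := by gcongr
      linarith [norm_nonneg (z - f y₀)]
    set ρ := ‖z - f y₀‖ with hρdef
    have hρ : 0 < ρ := by
      refine norm_pos_iff.2 (sub_ne_zero.2 fun h => hz.2 ⟨y₀, ⟨hy₀, ?_⟩, h.symm⟩)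
      rw [mem_closedBall, dist_comm]
      exact hdr.le
    have hρr : ρ < θ / 8 * r := by linarith
    have hρθ : 2 * ρ / θ < r / 4 := by
      rw [div_lt_iff₀ hθ]
      linarith
    obtain ⟨y, hyA, hyd, hyz⟩ := (hPA hy₀).2 (2 * ρ / θ) (by positivity) (by linarith) z (by
      rw [← hρdef, mul_div_cancel₀ _ hθ.ne']
      linarith)
    rw [mul_div_cancel₀ _ hθ.ne'] at hyz
    have hρL : ρ / (4 * L) ≤ ρ / 4 := by
      gcongr
      linarith
    have hρr' : ρ ≤ r / 8 := by nlinarith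
    have hball : ∀ p ∈ closedBall y (ρ / (4 * L)), ‖z - f p‖ ≤ ρ / 2 := by
      intro p hp
      have h1 : ‖f p - f y‖ ≤ ρ / 4 := by
        rw [← dist_eq_norm]
        calc dist (f p) (f y) ≤ L * dist p y := hf.dist_le_mul p y
          _ ≤ L * (ρ / (4 * L)) := by gcongr; exact hp
          _ = ρ / 4 := by field_simp
      have h2 := norm_sub_le_norm_sub_add_norm_sub (f p) (f y) z
      rw [norm_sub_rev]
      linarith
    have hdist : ∀ p ∈ closedBall y (ρ / (4 * L)), dist x p ≤ dist x y₀ + 2 * ρ / θ + ρ / 4 := by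
      intro p hp
      have h1 := dist_triangle4 x y₀ y p
      have h2 : dist p y ≤ ρ / (4 * L) := hp
      rw [dist_comm y₀, dist_comm y p] at h1
      linarith
    refine ⟨ρ, y, hρ, hρr.le, hyA, fun p hp => ⟨?_, ?_, fun hpP => ?_⟩⟩
    · rw [mem_preimage, mem_closedBall, dist_comm, dist_eq_norm]
      linarith [hball p hp]
    · rw [mem_closedBall, dist_comm]
      linarith [hdist p hp]
    · have h1 := hmin' p hpP
      have h2 := mul_le_mul_of_nonneg_left (hdist p hp) (by positivity : 0 ≤ θ / 8)
      have h3 : θ / 8 * (dist x y₀ + 2 * ρ / θ + ρ / 4) =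
          θ / 8 * dist x y₀ + ρ / 4 + θ * ρ / 32 := by
        field_simp
        ring
      have h4 : θ * ρ ≤ ρ := mul_le_of_le_one_left hρ.le hθ1
      linarith [hball p hp]
  choose! ρ y hρ hρr hyA hsub using key
  set ν : Measure (Fin n → ℝ) := (μH[n].restrict (closedBall x (3 * r) \ P)).map f with hν
  have hfm : Measurable f := hf.continuous.measurable
  have hνball : ∀ z s, ν (closedBall z s) =
      μH[n] (f ⁻¹' closedBall z s ∩ (closedBall x (3 * r) \ P)) := fun z s => by
    rw [hν, Measure.map_apply hfm isClosed_closedBall.measurableSet,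
      Measure.restrict_apply (hfm isClosed_closedBall.measurableSet)]
  have hνuniv : ν univ = μH[n] (closedBall x (3 * r) \ P) := by
    rw [hν, Measure.map_apply hfm MeasurableSet.univ, preimage_univ, Measure.restrict_apply_univ]
  obtain ⟨u, huE, hu, hcov, hsum⟩ := exists_countable_cover ν n (E := E) (S := univ) (ρ := ρ)
    (R := θ / 8 * r) (t := ENNReal.ofReal ((4 * L) ^ n * k))
    (fun z hz => ⟨hρ z hz, hρr z hz⟩) (fun z _ => subset_univ _) (fun z hz => by
      have h1 : ρ z / (4 * L) < 1 / k := by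
        calc ρ z / (4 * L) ≤ ρ z := div_le_self (hρ z hz).le (by linarith)
          _ ≤ θ / 8 * r := hρr z hz
          _ ≤ 1 * r := by gcongr; linarith
          _ < 1 / k := by rwa [one_mul]
      have h2 := (hAk (hyA z hz) (ρ z / (4 * L)) (by have := hρ z hz; positivity) h1).1
      have h3 : ENNReal.ofReal ((ρ z / (4 * L)) ^ n / k) ≤ ν (closedBall z (ρ z)) := by
        rw [hνball]
        exact h2.trans (measure_mono (hsub z hz))
      calc ENNReal.ofReal (ρ z) ^ n
          = ENNReal.ofReal ((4 * L) ^ n * k) * ENNReal.ofReal ((ρ z / (4 * L)) ^ n / k) := by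
            rw [← ENNReal.ofReal_mul (by positivity), ← ENNReal.ofReal_pow (hρ z hz).le]
            congr 1
            rw [div_pow]
            field_simp
        _ ≤ _ := by gcongr)
  have := hu.to_subtype
  calc volume E ≤ volume (⋃ z ∈ u, closedBall z (5 * ρ z)) := measure_mono hcov
    _ ≤ ∑' z : u, volume (closedBall (z : Fin n → ℝ) (5 * ρ z)) := measure_biUnion_le _ hu _
    _ = ∑' z : u, ENNReal.ofReal (10 ^ n) * ENNReal.ofReal (ρ z) ^ n := by
        refine tsum_congr fun z => ?_
        have h1 := hρ z (huE z.2)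
        rw [Real.volume_pi_closedBall _ (by positivity), Fintype.card_fin,
          ← ENNReal.ofReal_pow h1.le, ← ENNReal.ofReal_mul (by positivity), ← mul_pow]
        congr 2
        ring
    _ ≤ ENNReal.ofReal (10 ^ n) * (ENNReal.ofReal ((4 * L) ^ n * k) * ν univ) := by
        rw [ENNReal.tsum_mul_left]
        gcongr
    _ = _ := by
        rw [hνuniv, ← mul_assoc, ← ENNReal.ofReal_mul (by positivity), ← mul_assoc, ← mul_pow]
        congr 4
        ring

end NullImage

section Antilipschitz

variable {X : Type*} [MetricSpace X] {n : ℕ} {k θ r₀ : ℝ} {A P : Set X} {L : ℝ≥0}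
  {f : X → Fin n → ℝ}

/-- If the images of small balls around two points almost fill the expected balls, then
injectivity forces the images of these points to be far apart. -/
theorem le_norm_sub_of_volume_lt (hθ : 0 < θ) (hinj : InjOn f P) {x y : X} {r : ℝ} (hr : 0 < r)
    (hxy : 2 * r < dist x y)
    (hx : volume (ball (f x) (θ / 8 * r) \ f '' (P ∩ closedBall x r)) <
      ENNReal.ofReal ((θ / 8 * r) ^ n / 2))
    (hy : volume (ball (f y) (θ / 8 * r) \ f '' (P ∩ closedBall y r)) <
      ENNReal.ofReal ((θ / 8 * r) ^ n / 2)) :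
    θ / 16 * r ≤ ‖f x - f y‖ := by
  by_contra! hlt
  have hcov : ball (f x) (θ / 16 * r) ⊆ ball (f x) (θ / 8 * r) \ f '' (P ∩ closedBall x r) ∪
      ball (f y) (θ / 8 * r) \ f '' (P ∩ closedBall y r) := by
    intro w hw
    rw [mem_ball, dist_eq_norm] at hw
    have h1 : w ∈ ball (f x) (θ / 8 * r) := by
      rw [mem_ball, dist_eq_norm]
      have : 0 < θ / 16 * r := by positivity
      linarith
    have h2 : w ∈ ball (f y) (θ / 8 * r) := by
      rw [mem_ball, dist_eq_norm]
      have := norm_sub_le_norm_sub_add_norm_sub w (f x) (f y)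
      linarith
    by_contra hw'
    rw [mem_union, not_or] at hw'
    obtain ⟨a, ha, haw⟩ := not_not.1 fun h => hw'.1 ⟨h1, h⟩
    obtain ⟨b, hb, hbw⟩ := not_not.1 fun h => hw'.2 ⟨h2, h⟩
    obtain rfl : a = b := hinj ha.1 hb.1 (haw.trans hbw.symm)
    have h3 := dist_triangle_left x y a
    have h4 : dist a x ≤ r := ha.2
    have h5 : dist a y ≤ r := hb.2
    linarith
  have h1 := (measure_mono hcov).trans (measure_union_le (μ := volume) _ _)
  rw [Real.volume_pi_ball _ (by positivity), Fintype.card_fin] at h1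
  refine (h1.trans_lt (ENNReal.add_lt_add hx hy)).ne ?_
  rw [← ENNReal.ofReal_add (by positivity) (by positivity), add_halves]
  congr 2
  ring

variable [MeasurableSpace X] [BorelSpace X] [CompactSpace X]

theorem exists_isClosed_antilipschitz (hfin : μH[n] (univ : Set X) < ∞) (hk : 1 ≤ k)
    (hAk : A ⊆ regularPoints X n k) (hf : LipschitzWith L f) (hL : 1 ≤ L) (hθ : 0 < θ)
    (hθ1 : θ ≤ 1) (hr₀ : 0 < r₀) (hP : IsClosed P) (hPA : P ⊆ densePoints f A θ r₀)
    (hinj : InjOn f P) (hpos : 0 < μH[n] P) :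
    ∃ E ⊆ P, IsClosed E ∧ 0 < μH[n] E ∧ ∃ c > 0, ∀ x ∈ E, ∀ y ∈ E, c * dist x y ≤ ‖f x - f y‖ := by
  have hL' : (0 : ℝ) < L := by exact_mod_cast zero_lt_one.trans_le hL
  set C : ℝ := (40 * L) ^ n * k with hC
  have hC0 : 0 < C := by positivity
  set c₀ : ℝ := (θ / 24) ^ n / (2 * C) with hc₀
  set N : Set X := {x ∈ P | ∀ δ > 0, ∃ r, 0 < r ∧ r < δ ∧
    ENNReal.ofReal (c₀ * r ^ n) ≤ μH[n] (closedBall x r \ P)} with hN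
  have hN0 : μH[n] N = 0 := ae_density_compl hfin hP.measurableSet (by positivity)
  set P' : ℕ → Set X := fun j => {x ∈ P | ∀ r, 0 < r → r < 1 / ((j : ℝ) + 1) →
    μH[n] (closedBall x r \ P) < ENNReal.ofReal (c₀ * r ^ n)} with hP'
  have hcov : P ⊆ N ∪ ⋃ j, P' j := by
    intro x hx
    by_cases hxN : x ∈ N
    · exact Or.inl hxN
    · refine Or.inr (mem_iUnion.2 ?_)
      have h1 : ∃ δ > 0, ∀ r, 0 < r → r < δ →
          μH[n] (closedBall x r \ P) < ENNReal.ofReal (c₀ * r ^ n) := by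
        by_contra! h
        exact hxN ⟨hx, h⟩
      obtain ⟨δ, hδ, h2⟩ := h1
      obtain ⟨j, hj⟩ := exists_nat_one_div_lt hδ
      exact ⟨j, hx, fun r hr hrj => h2 r hr (hrj.trans hj)⟩
  obtain ⟨j, hj⟩ : ∃ j, 0 < μH[n] (P' j) := by
    by_contra! h
    refine hpos.ne' (measure_mono_null hcov (measure_union_null hN0 (measure_iUnion_null fun j => ?_)))
    exact le_antisymm (h j) zero_le
  set s : ℝ := min (1 / ((j : ℝ) + 1)) (min r₀ (1 / k)) with hs
  have hs0 : 0 < s := by positivity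
  obtain ⟨z, hz⟩ : ∃ z, 0 < μH[n] (P' j ∩ ball z (s / 2)) := by
    obtain ⟨t, -, htfin, ht⟩ := isCompact_univ.finite_cover_balls (X := X) (half_pos hs0)
    by_contra! h
    refine hj.ne' (measure_mono_null (t := ⋃ z ∈ t, P' j ∩ ball z (s / 2)) ?_
      ((measure_biUnion_null_iff htfin.countable).2 fun z _ => le_antisymm (h z) zero_le))
    rw [← inter_iUnion₂]
    exact subset_inter Subset.rfl ((subset_univ _).trans ht)
  have hsub : P' j ∩ ball z (s / 2) ⊆ P := fun x hx => hx.1.1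
  refine ⟨closure (P' j ∩ ball z (s / 2)), closure_minimal hsub hP, isClosed_closure,
    hz.trans_le (measure_mono subset_closure), θ / 48, by positivity, fun x hx y hy => ?_⟩
  have hvol : ∀ x ∈ P' j ∩ ball z (s / 2), ∀ r, 0 < r → 3 * r < s →
      volume (ball (f x) (θ / 8 * r) \ f '' (P ∩ closedBall x r)) <
        ENNReal.ofReal ((θ / 8 * r) ^ n / 2) := by
    intro x hx r hr hrs
    have h1 := min_le_left (1 / ((j : ℝ) + 1)) (min r₀ (1 / k))
    have h2 := (min_le_right (1 / ((j : ℝ) + 1)) (min r₀ (1 / k))).trans (min_le_left _ _)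
    have h3 := (min_le_right (1 / ((j : ℝ) + 1)) (min r₀ (1 / k))).trans (min_le_right _ _)
    refine (volume_ball_diff_image_le hk hAk hf hL hθ hθ1 hP hPA hx.1.1 hr (by linarith)
      (by linarith)).trans_lt ?_
    have h4 := hx.1.2 (3 * r) (by positivity) (by linarith)
    calc ENNReal.ofReal C * μH[n] (closedBall x (3 * r) \ P)
        < ENNReal.ofReal C * ENNReal.ofReal (c₀ * (3 * r) ^ n) :=
          ENNReal.mul_lt_mul_right (by simpa using hC0) ENNReal.ofReal_ne_top h4
      _ = _ := by
          rw [← ENNReal.ofReal_mul hC0.le, hc₀, show θ / 8 * r = θ / 24 * (3 * r) by ring,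
            mul_pow (θ / 24)]
          congr 1
          field_simp
  have hclosed : IsClosed {p : X × X | θ / 48 * dist p.1 p.2 ≤ ‖f p.1 - f p.2‖} := by
    have := hf.continuous
    exact isClosed_le (by fun_prop) (by fun_prop)
  have hmem : (x, y) ∈ closure ((P' j ∩ ball z (s / 2)) ×ˢ (P' j ∩ ball z (s / 2))) := by
    rw [closure_prod_eq]
    exact ⟨hx, hy⟩
  refine closure_minimal ?_ hclosed hmem
  rintro ⟨x, y⟩ ⟨hx, hy⟩
  simp only at hx hy
  rcases eq_or_ne x y with rfl | hne
  · simp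
  have hd : 0 < dist x y := dist_pos.2 hne
  have hds : dist x y < s := by
    have h1 := dist_triangle_right x y z
    have h2 : dist x z < s / 2 := hx.2
    have h3 : dist y z < s / 2 := hy.2
    linarith
  have h := le_norm_sub_of_volume_lt hθ hinj (x := x) (y := y) (r := dist x y / 3) (by positivity)
    (by linarith) (hvol x hx _ (by positivity) (by linarith))
    (hvol y hy _ (by positivity) (by linarith))
  calc θ / 48 * dist x y = θ / 16 * (dist x y / 3) := by ring
    _ ≤ _ := h

/-- If `f` is antilipschitz on no set of positive measure, then the image of the set of dense points
is negligible. -/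
theorem volume_image_densePoints_eq_zero (hfin : μH[n] (univ : Set X) < ∞) (hk : 1 ≤ k)
    (hA : IsClosed A) (hAk : A ⊆ regularPoints X n k) (hf : LipschitzWith L f) (hL : 1 ≤ L)
    (hθ : 0 < θ) (hθ1 : θ ≤ 1) (hr₀ : 0 < r₀)
    (hnull : ∀ E ⊆ A, IsClosed E → (∃ c > 0, ∀ x ∈ E, ∀ y ∈ E, c * dist x y ≤ ‖f x - f y‖) →
      μH[n] E = 0) :
    volume (f '' densePoints f A θ r₀) = 0 := by
  by_contra hne
  obtain ⟨P, hPM, hP, hinj, hPpos⟩ := exists_isClosed_injOn hf.continuous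
    (isClosed_densePoints hf.continuous hA θ r₀) (pos_iff_ne_zero.2 hne)
  have hpos : 0 < μH[n] P := by
    by_contra! h
    have h1 := volume_image_le hf P
    rw [le_antisymm h zero_le, mul_zero] at h1
    exact hPpos.not_ge h1
  obtain ⟨E, hEP, hE, hEpos, hc⟩ :=
    exists_isClosed_antilipschitz hfin hk hAk hf hL hθ hθ1 hr₀ hP hPM hinj hpos
  exact hEpos.ne' (hnull E (hEP.trans (hPM.trans densePoints_subset)) hE hc)

end Antilipschitz

section Collapse

variable {X : Type*} [MetricSpace X] [MeasurableSpace X] [BorelSpace X] {n : ℕ}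

/-- A modification `g` of the map `f` on a neighborhood `W` of `x` of size comparable to `r` that
maps the intersection of `W` with `A` to a set of small volume. -/
structure IsCollapse (f : X → Fin n → ℝ) (A : Set X) (C : ℝ≥0) (s c : ℝ) (x : X) (r : ℝ)
    (W : Set X) (g : X → Fin n → ℝ) : Prop where
  isClosed : IsClosed W
  subset_closedBall : W ⊆ closedBall x r
  closedBall_subset : closedBall x (c * r) ⊆ W
  continuous : Continuous g
  eq_of_notMem : ∀ y ∉ W, g y = f y
  norm_sub_le : ∀ y, ‖g y - f y‖ ≤ r
  volume_image_le : volume (g '' W) ≤ (C : ℝ≥0∞) ^ n * (ENNReal.ofReal s * μH[n] W + μH[n] (W \ A))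

variable {k : ℝ} {A : Set X} {L : ℝ≥0} {f : X → Fin n → ℝ}

/-- Among concentric sets of polynomially comparable measures there is one that can be enlarged
with only a small gain in measure. -/
theorem exists_measure_le_mul (hk : 1 ≤ k) (hAk : A ⊆ regularPoints X n k)
    (hf : LipschitzWith L f) (hL : 1 ≤ L) {s : ℝ} (hs : 0 < s) {N : ℕ} (hN : 0 < N)
    (hNs : k ^ 2 * (4 * N * L) ^ n < (1 + s) ^ N) {x : X} (hx : x ∈ A) {r θ : ℝ} (hr : 0 < r)
    (hrk : r < 1 / k) (hθ : θ = 1 / (4 * N)) {w : Fin n → ℝ} (hw : ‖w - f x‖ < θ * r) :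
    ∃ a, r / 2 ≤ a ∧ a + 2 * θ * r ≤ r ∧
      μH[n] (closedBall x (a + 2 * θ * r) ∩ f ⁻¹' closedBall w (2 * θ * r)) ≤
        ENNReal.ofReal (1 + s) * μH[n] (closedBall x a ∩ f ⁻¹' closedBall w (2 * θ * r)) := by
  have hL' : (1 : ℝ) ≤ L := by exact_mod_cast hL
  have hN' : (1 : ℝ) ≤ N := by exact_mod_cast hN
  have hθ0 : 0 < θ := by rw [hθ]; positivity
  have hθ1 : θ ≤ 1 / 4 := by
    rw [hθ]
    exact one_div_le_one_div_of_le (by norm_num) (by linarith)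
  by_contra! h
  set R := 2 * θ * r with hR
  have hNR : N * R = r / 2 := by
    rw [hR, hθ]
    field_simp
    norm_num
  have hpow : ∀ j : ℕ, j ≤ N → ENNReal.ofReal (1 + s) ^ j *
      μH[n] (closedBall x (r / 2) ∩ f ⁻¹' closedBall w R) ≤
        μH[n] (closedBall x (r / 2 + j * R) ∩ f ⁻¹' closedBall w R) := by
    intro j
    induction j with
    | zero => simp
    | succ j ih =>
      intro hj
      have h1 : ((j : ℝ) + 1) * R ≤ N * R := by
        gcongr
        exact_mod_cast hj
      refine le_trans ?_ ((h (r / 2 + j * R) (le_add_of_nonneg_right (by positivity))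
        (by linarith)).le.trans_eq ?_)
      · rw [pow_succ', mul_assoc]
        gcongr
        exact ih (Nat.le_of_succ_le hj)
      · push_cast
        congr 3
        ring
  have hlow : closedBall x (θ * r / L) ⊆ closedBall x (r / 2) ∩ f ⁻¹' closedBall w R := by
    intro y hy
    have hy' : dist y x ≤ θ * r / L := hy
    have h1 : θ * r / L ≤ θ * r := div_le_self (by positivity) hL'
    have h2 : θ * r ≤ 1 / 4 * r := by gcongr
    refine ⟨mem_closedBall.2 (by linarith), ?_⟩
    rw [mem_preimage, mem_closedBall, dist_eq_norm]
    have h3 : ‖f y - f x‖ ≤ θ * r := by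
      rw [← dist_eq_norm]
      calc dist (f y) (f x) ≤ L * dist y x := hf.dist_le_mul y x
        _ ≤ L * (θ * r / L) := by gcongr
        _ = θ * r := by field_simp
    have h4 := norm_sub_le_norm_sub_add_norm_sub (f y) (f x) w
    rw [norm_sub_rev (f x)] at h4
    linarith
  have hrk' : θ * r / L < 1 / k := by
    have h1 : θ * r / L ≤ θ * r := div_le_self (by positivity) hL'
    have h2 : θ * r ≤ 1 / 4 * r := by gcongr
    linarith
  have h1 := ((hAk hx) (θ * r / L) (by positivity) hrk').1.trans (measure_mono hlow)
  have h2 := hpow N le_rfl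
  rw [hNR, add_halves] at h2
  have h3 := (h2.trans (measure_mono inter_subset_left)).trans ((hAk hx) r hr hrk).2
  have h4 : ENNReal.ofReal ((1 + s) ^ N * ((θ * r / L) ^ n / k)) ≤ ENNReal.ofReal (k * r ^ n) := by
    refine le_trans ?_ h3
    rw [ENNReal.ofReal_mul (by positivity), ENNReal.ofReal_pow (by positivity)]
    gcongr
  rw [ENNReal.ofReal_le_ofReal_iff (by positivity)] at h4
  have h5 : (1 + s) ^ N * ((θ * r / L) ^ n / k) = r ^ n / (k * (4 * N * L) ^ n) * (1 + s) ^ N := by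
    rw [hθ, show 1 / (4 * (N : ℝ)) * r / L = r / (4 * N * L) by field_simp, div_pow]
    field_simp
  have h6 : k * r ^ n = r ^ n / (k * (4 * N * L) ^ n) * (k ^ 2 * (4 * N * L) ^ n) := by
    field_simp
  rw [h5, h6] at h4
  exact (lt_of_mul_lt_mul_left (h4.trans_lt' (mul_lt_mul_of_pos_left hNs (by positivity)))
    (by positivity)).false

theorem exists_isCollapse (hk : 1 ≤ k) (hAk : A ⊆ regularPoints X n k)
    (hf : LipschitzWith L f) (hL : 1 ≤ L) {s : ℝ} (hs : 0 < s) {N : ℕ} (hN : 0 < N)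
    (hNs : k ^ 2 * (4 * N * L) ^ n < (1 + s) ^ N) {x : X} (hx : x ∈ A) {r θ : ℝ} (hr : 0 < r)
    (hrk : r < 1 / k) (hθ : θ = 1 / (4 * N)) {w : Fin n → ℝ} (hw : ‖w - f x‖ < θ * r)
    (hfar : ∀ y ∈ A, dist y x ≤ r → θ * r / 8 < ‖f y - w‖) :
    ∃ W g, IsCollapse f A (34 * L + 1) s (θ / L) x r W g := by
  have hL' : (1 : ℝ) ≤ L := by exact_mod_cast hL
  have hN' : (1 : ℝ) ≤ N := by exact_mod_cast hN
  have hθ0 : 0 < θ := by rw [hθ]; positivity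
  have hθ1 : θ ≤ 1 / 4 := by
    rw [hθ]
    exact one_div_le_one_div_of_le (by norm_num) (by linarith)
  obtain ⟨a, har, haR, hma⟩ := exists_measure_le_mul hk hAk hf hL hs hN hNs hx hr hrk hθ hw
  set R := 2 * θ * r with hR
  have hR0 : 0 < R := by positivity
  have hρ : 0 < θ * r / 8 := by positivity
  have hρR : θ * r / 8 ≤ R := by linarith
  have hθr : θ * r ≤ 1 / 4 * r := by gcongr
  set V := closedBall x a ∩ f ⁻¹' closedBall w R with hV
  set W := closedBall x (a + R) ∩ f ⁻¹' closedBall w R with hW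
  have hVW : V ⊆ W := inter_subset_inter_left _ (closedBall_subset_closedBall (by linarith))
  have hVc : IsClosed V := isClosed_closedBall.inter (isClosed_closedBall.preimage hf.continuous)
  have hWc : IsClosed W := isClosed_closedBall.inter (isClosed_closedBall.preimage hf.continuous)
  have hWr : W ⊆ closedBall x r := inter_subset_left.trans (closedBall_subset_closedBall haR)
  set t : X → ℝ := fun y => max 0 (min 1 ((a + R - dist y x) / R)) with ht
  have ht0 : ∀ y, 0 ≤ t y := fun y => le_max_left _ _
  have ht1 : ∀ y, t y ≤ 1 := fun y => max_le zero_le_one (min_le_left _ _)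
  have htL : ∀ y z, R * |t y - t z| ≤ dist y z := by
    intro y z
    have h1 : LipschitzWith (1 / R).toNNReal t := by
      refine LipschitzWith.const_max (LipschitzWith.const_min ?_ 1) 0
      refine LipschitzWith.of_dist_le_mul fun y z => ?_
      rw [Real.coe_toNNReal _ (by positivity), Real.dist_eq, ← sub_div, sub_sub_sub_cancel_left,
        abs_div, abs_of_pos hR0, abs_sub_comm, div_eq_inv_mul, one_div]
      gcongr
      exact abs_dist_sub_le _ _ _
    have h2 := h1.dist_le_mul y z
    rw [Real.coe_toNNReal _ (by positivity), Real.dist_eq] at h2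
    calc R * |t y - t z| ≤ R * (1 / R * dist y z) := by gcongr
      _ = dist y z := by field_simp
  set p := radialPush w (θ * r / 8) R with hp
  set g : X → Fin n → ℝ := fun y => f y + t y • (p (f y) - f y) with hg
  have hpL : ∀ u v, ‖p u - p v‖ ≤ 32 * ‖u - v‖ := by
    intro u v
    have h1 := (lipschitzWith_radialPush hρ hρR w).dist_le_mul u v
    rw [Real.coe_toNNReal _ (by positivity), show 2 * R / (θ * r / 8) = 32 by
      rw [hR]; field_simp; norm_num, dist_eq_norm, dist_eq_norm] at h1
    exact h1
  have hpR : ∀ u, ‖p u - u‖ ≤ R := fun u => norm_radialPush_sub_self hρ hρR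
  have hgL : LipschitzWith (34 * L + 1) g := by
    refine LipschitzWith.of_dist_le_mul fun y z => ?_
    have hfyz : ‖f y - f z‖ ≤ L * dist y z := by
      rw [← dist_eq_norm]; exact hf.dist_le_mul y z
    have h1 : g y - g z = (f y - f z) + t y • ((p (f y) - p (f z)) - (f y - f z)) +
        (t y - t z) • (p (f z) - f z) := by
      simp only [hg, smul_sub, sub_smul]
      abel
    rw [dist_eq_norm, h1]
    have h2 : ‖t y • ((p (f y) - p (f z)) - (f y - f z))‖ ≤ 33 * ‖f y - f z‖ := by
      rw [norm_smul, Real.norm_of_nonneg (ht0 y)]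
      calc t y * ‖(p (f y) - p (f z)) - (f y - f z)‖
          ≤ 1 * (32 * ‖f y - f z‖ + ‖f y - f z‖) := by
            gcongr
            · exact ht1 y
            · exact (norm_sub_le _ _).trans (by gcongr; exact hpL _ _)
        _ = _ := by ring
    have h3 : ‖(t y - t z) • (p (f z) - f z)‖ ≤ dist y z := by
      rw [norm_smul, Real.norm_eq_abs]
      calc |t y - t z| * ‖p (f z) - f z‖ ≤ |t y - t z| * R := by gcongr; exact hpR _
        _ = R * |t y - t z| := mul_comm _ _
        _ ≤ _ := htL y z
    have h4 := norm_add₃_le (a := f y - f z) (b := t y • ((p (f y) - p (f z)) - (f y - f z)))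
      (c := (t y - t z) • (p (f z) - f z))
    push_cast
    linarith
  refine ⟨W, g, hWc, hWr, ?_, hgL.continuous, ?_, ?_, ?_⟩
  · intro y hy
    have hy' : dist y x ≤ θ / L * r := hy
    have h1 : θ / L * r ≤ θ * r := by
      gcongr
      exact div_le_self hθ0.le hL'
    refine ⟨mem_closedBall.2 (by linarith), ?_⟩
    rw [mem_preimage, mem_closedBall, dist_eq_norm]
    have h3 : ‖f y - f x‖ ≤ θ * r := by
      rw [← dist_eq_norm]
      calc dist (f y) (f x) ≤ L * dist y x := hf.dist_le_mul y x
        _ ≤ L * (θ / L * r) := by gcongr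
        _ = θ * r := by field_simp
    have h4 := norm_sub_le_norm_sub_add_norm_sub (f y) (f x) w
    rw [norm_sub_rev (f x)] at h4
    linarith
  · intro y hy
    rcases lt_or_ge (a + R) (dist y x) with h | h
    · have h1 : t y = 0 :=
        max_eq_left ((min_le_right _ _).trans (div_nonpos_of_nonpos_of_nonneg (by linarith) hR0.le))
      simp [hg, h1]
    · have h1 : R ≤ ‖f y - w‖ := by
        by_contra! h2
        exact hy ⟨h, mem_closedBall.2 (by rw [dist_eq_norm]; exact h2.le)⟩
      simp [hg, hp, radialPush_of_le hρ hρR h1]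
  · intro y
    rw [hg, add_sub_cancel_left, norm_smul, Real.norm_of_nonneg (ht0 y)]
    calc t y * ‖p (f y) - f y‖ ≤ 1 * R := by
          gcongr
          · exact ht1 y
          · exact hpR _
      _ ≤ r := by linarith
  · have hsphere : g '' (V ∩ A) ⊆ sphere w R := by
      rintro _ ⟨y, ⟨hyV, hyA⟩, rfl⟩
      have h1 : t y = 1 := by
        have h2 : dist y x ≤ a := hyV.1
        have h3 : 1 ≤ (a + R - dist y x) / R := by
          rw [le_div_iff₀ hR0]
          linarith
        simp only [ht, min_eq_left h3, max_eq_right zero_le_one]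
      have h2 : g y = p (f y) := by
        simp only [hg, h1, one_smul, add_sub_cancel]
      rw [mem_sphere, h2, dist_eq_norm]
      refine norm_radialPush_sub hρ hρR (hfar y hyA (hWr (hVW hyV))).le ?_
      rw [← dist_eq_norm]
      exact hyV.2
    have hnull : volume (g '' (V ∩ A)) = 0 :=
      measure_mono_null hsphere (Measure.addHaar_sphere_of_ne_zero _ w hR0.ne')
    have hVfin : μH[n] V ≠ ∞ := by
      refine ((measure_mono ((hVW.trans hWr))).trans_lt ?_).ne
      exact ((hAk hx) r hr hrk).2.trans_lt ENNReal.ofReal_lt_top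
    have hdiff : μH[n] (W \ V) ≤ ENNReal.ofReal s * μH[n] W := by
      rw [measure_sdiff hVW hVc.measurableSet.nullMeasurableSet hVfin, tsub_le_iff_right]
      refine hma.trans ?_
      rw [add_comm 1 s, ENNReal.ofReal_add hs.le zero_le_one, ENNReal.ofReal_one, add_mul, one_mul]
      gcongr
    calc volume (g '' W) ≤ volume (g '' (V ∩ A) ∪ g '' (W \ V ∪ W \ A)) := by
          rw [← image_union]
          refine measure_mono (image_mono fun y hy => ?_)
          by_cases h1 : y ∈ V <;> by_cases h2 : y ∈ A <;> simp [h1, h2, hy]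
      _ ≤ volume (g '' (W \ V ∪ W \ A)) := by
          refine (measure_union_le _ _).trans_eq ?_
          rw [hnull, zero_add]
      _ ≤ ((34 * L + 1 : ℝ≥0) : ℝ≥0∞) ^ n * μH[n] (W \ V ∪ W \ A) := volume_image_le hgL _
      _ ≤ _ := by
          gcongr
          exact (measure_union_le _ _).trans (by gcongr)

end Collapse

section Perturbation

variable {X : Type*} [MetricSpace X] [MeasurableSpace X] [BorelSpace X] {n : ℕ}
  {k : ℝ} {A : Set X} {L : ℝ≥0} {f : X → Fin n → ℝ}

/-- Collapses supported on disjoint sets can be performed simultaneously. -/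
theorem exists_forall_eq_of_isCollapse {C : ℝ≥0} {s c η : ℝ} (hf : Continuous f) (hη : 0 < η)
    (hA : MeasurableSet A) {v : Finset (X × ℝ × Set X × (X → Fin n → ℝ))}
    (hv : ∀ a ∈ v, a.2.1 ≤ η ∧ IsCollapse f A C s c a.1 a.2.1 a.2.2.1 a.2.2.2)
    (hd : (v : Set (X × ℝ × Set X × (X → Fin n → ℝ))).PairwiseDisjoint (fun a => a.2.2.1)) :
    ∃ g, Continuous g ∧ (∀ x, ‖g x - f x‖ ≤ η) ∧ (∀ y ∉ ⋃ a ∈ v, a.2.2.1, g y = f y) ∧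
      volume (g '' ⋃ a ∈ v, a.2.2.1) ≤ (C : ℝ≥0∞) ^ n *
        (ENNReal.ofReal s * μH[n] (⋃ a ∈ v, a.2.2.1) + μH[n] ((⋃ a ∈ v, a.2.2.1) \ A)) := by
  set g : X → Fin n → ℝ := fun y => f y + ∑ a ∈ v, (a.2.2.2 y - f y) with hg
  have hgW : ∀ a ∈ v, ∀ y ∈ a.2.2.1, g y = a.2.2.2 y := by
    intro a ha y hy
    have : ∑ b ∈ v, (b.2.2.2 y - f y) = a.2.2.2 y - f y := by
      refine Finset.sum_eq_single_of_mem a ha fun b hb hba => ?_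
      rw [(hv b hb).2.eq_of_notMem y fun hyb => disjoint_left.1 (hd hb ha hba) hyb hy, sub_self]
    simp only [hg, this, add_sub_cancel]
  have hgf : ∀ y ∉ ⋃ a ∈ v, a.2.2.1, g y = f y := by
    intro y hy
    simp only [mem_iUnion, not_exists] at hy
    simp only [hg, add_eq_left]
    refine Finset.sum_eq_zero fun b hb => ?_
    rw [(hv b hb).2.eq_of_notMem y (hy b hb), sub_self]
  refine ⟨g, ?_, ?_, hgf, ?_⟩
  · exact hf.add (continuous_finsetSum _ fun a ha => (hv a ha).2.continuous.sub hf)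
  · intro y
    by_cases hy : y ∈ ⋃ a ∈ v, a.2.2.1
    · obtain ⟨a, ha, hya⟩ := mem_iUnion₂.1 hy
      rw [hgW a ha y hya]
      exact ((hv a ha).2.norm_sub_le y).trans (hv a ha).1
    · rw [hgf y hy, sub_self, norm_zero]
      exact hη.le
  · have hWm : ∀ a ∈ v, MeasurableSet a.2.2.1 := fun a ha => (hv a ha).2.isClosed.measurableSet
    have hd' : (v : Set (X × ℝ × Set X × (X → Fin n → ℝ))).PairwiseDisjoint
        (fun a => a.2.2.1 \ A) := hd.mono fun a => sdiff_subset
    have hWA : (⋃ a ∈ v, a.2.2.1) \ A = ⋃ a ∈ v, a.2.2.1 \ A := by simp only [iUnion_sdiff]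
    rw [hWA, measure_biUnion_finset hd hWm,
      measure_biUnion_finset hd' fun a ha => (hWm a ha).diff hA, Finset.mul_sum,
      ← Finset.sum_add_distrib, Finset.mul_sum, image_iUnion₂]
    refine (measure_biUnion_finset_le v _).trans (Finset.sum_le_sum fun a ha => ?_)
    rw [image_congr (hgW a ha)]
    exact (hv a ha).2.volume_image_le

variable [CompactSpace X]

/-- Up to a set of small measure, the points that are not in `densePoints` can be covered by
finitely many disjoint sets that support a collapse. -/
theorem exists_finset_isCollapse (hfin : μH[n] (univ : Set X) < ∞) (hk : 1 ≤ k)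
    (hAk : A ⊆ regularPoints X n k) (hf : LipschitzWith L f) (hL : 1 ≤ L) {s : ℝ} (hs : 0 < s)
    {N : ℕ} (hN : 0 < N) (hNs : k ^ 2 * (4 * N * L) ^ n < (1 + s) ^ N) {θ : ℝ}
    (hθ : θ = 1 / (4 * N)) {U : Set X} (hU : IsOpen U) (hAU : A ⊆ U) {η : ℝ} (hη : 0 < η)
    {δ : ℝ≥0∞} (hδ : 0 < δ) :
    ∃ v : Finset (X × ℝ × Set X × (X → Fin n → ℝ)),
      (∀ a ∈ v, a.2.2.1 ⊆ U ∧ a.2.1 ≤ η ∧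
        IsCollapse f A (34 * L + 1) s (θ / L) a.1 a.2.1 a.2.2.1 a.2.2.2) ∧
      (v : Set (X × ℝ × Set X × (X → Fin n → ℝ))).PairwiseDisjoint (fun a => a.2.2.1) ∧
      μH[n] ((A \ ⋃ m : ℕ, densePoints f A θ (1 / (m + 1))) \ ⋃ a ∈ v, a.2.2.1) ≤ δ := by
  have : IsFiniteMeasure (μH[n] : Measure X) := ⟨hfin⟩
  have hL' : (1 : ℝ) ≤ L := by exact_mod_cast hL
  have hN' : (1 : ℝ) ≤ N := by exact_mod_cast hN
  have hθ0 : 0 < θ := by rw [hθ]; positivity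
  have hθ1 : θ ≤ 1 := by
    rw [hθ, div_le_one (by positivity)]
    linarith
  set c : ℝ := θ / L with hc
  have hc0 : 0 < c := by positivity
  have hc1 : c ≤ 1 := by
    rw [hc, div_le_one (by positivity)]
    linarith
  set t : Set (X × ℝ × Set X × (X → Fin n → ℝ)) :=
    {a | a.1 ∈ A ∧ 0 < a.2.1 ∧ a.2.1 < 1 / (3 * k) ∧ a.2.1 ≤ η ∧ a.2.2.1 ⊆ U ∧
      IsCollapse f A (34 * L + 1) s c a.1 a.2.1 a.2.2.1 a.2.2.2} with ht
  have h3k : 1 / (3 * k) * 3 = 1 / k := by field_simp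
  have hcover : ∃ u ⊆ t, u.Countable ∧ u.PairwiseDisjoint (fun a => a.2.2.1) ∧
      μH[n] ((A \ ⋃ m : ℕ, densePoints f A θ (1 / (m + 1))) \ ⋃ a ∈ u, a.2.2.1) = 0 := by
    refine Vitali.exists_disjoint_covering_ae (μH[n] : Measure X) _ t
      (Real.toNNReal (k ^ 2 * (3 / c) ^ n)) (fun a => a.2.1) (fun a => a.1) (fun a => a.2.2.1)
      (fun a ha => ha.2.2.2.2.2.subset_closedBall) ?_ ?_ (fun a ha => ha.2.2.2.2.2.isClosed) ?_
    · rintro ⟨x, r, W, g⟩ ⟨hx, hr, hrk, -, -, hW⟩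
      dsimp only at hx hr hrk hW ⊢
      have h1 := (hAk hx (3 * r) (by positivity) (by linarith)).2
      have h2 := (hAk hx (c * r) (by positivity)
        (by nlinarith [mul_le_mul_of_nonneg_right hc1 hr.le])).1
      calc μH[n] (closedBall x (3 * r)) ≤ ENNReal.ofReal (k * (3 * r) ^ n) := h1
        _ = ENNReal.ofReal (k ^ 2 * (3 / c) ^ n) * ENNReal.ofReal ((c * r) ^ n / k) := by
            rw [← ENNReal.ofReal_mul (by positivity)]
            congr 1
            rw [div_pow, mul_pow, mul_pow]
            field_simp
        _ ≤ _ := by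
            gcongr
            exacts [le_rfl, h2.trans (measure_mono hW.closedBall_subset)]
    · rintro ⟨x, r, W, g⟩ ⟨hx, hr, hrk, -, -, hW⟩
      exact ⟨x, interior_mono hW.closedBall_subset
        (ball_subset_interior_closedBall (mem_ball_self (mul_pos hc0 hr)))⟩
    · intro x hx ε hε
      obtain ⟨hxA, hxd⟩ := hx
      obtain ⟨ρ, hρ, hρU⟩ := nhds_basis_closedBall.mem_iff.1 (hU.mem_nhds (hAU hxA))
      obtain ⟨m, hm⟩ := exists_nat_one_div_lt
        (lt_min (lt_min hε hη) (lt_min hρ (by positivity : 0 < 1 / (3 * k))))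
      simp only [lt_min_iff] at hm
      simp only [mem_iUnion, not_exists] at hxd
      have hxm := hxd m
      simp only [densePoints, mem_ofPred_eq, not_and] at hxm
      have h := hxm hxA
      push Not at h
      obtain ⟨r, hr, hrm, w, hw, hfar⟩ := h
      obtain ⟨W, g, hWg⟩ := exists_isCollapse hk hAk hf hL hs hN hNs hxA hr
        (by have : 1 / (3 * k) ≤ 1 / k := by gcongr; linarith
            linarith) hθ hw hfar
      exact ⟨(x, r, W, g), ⟨hxA, hr, by dsimp only; linarith, by dsimp only; linarith,
        hWg.subset_closedBall.trans ((closedBall_subset_closedBall (by linarith)).trans hρU), hWg⟩,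
        by dsimp only; linarith, rfl⟩
  obtain ⟨u, hut, huc, hud, hu0⟩ := hcover
  have : Countable u := huc.to_subtype
  have hsum : ∑' a : u, μH[n] a.1.2.2.1 ≠ ∞ := by
    rw [← measure_biUnion huc hud fun a ha => (hut ha).2.2.2.2.2.isClosed.measurableSet]
    exact measure_ne_top _ _
  obtain ⟨v, hv⟩ := ((ENNReal.tendsto_tsum_compl_atTop_zero hsum).eventually_lt_const hδ).exists
  refine ⟨v.map (Function.Embedding.subtype _), ?_, ?_, ?_⟩
  · intro a ha
    obtain ⟨b, -, rfl⟩ := Finset.mem_map.1 ha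
    exact ⟨(hut b.2).2.2.2.2.1, (hut b.2).2.2.2.1, (hut b.2).2.2.2.2.2⟩
  · refine hud.subset fun a ha => ?_
    obtain ⟨b, -, rfl⟩ := Finset.mem_map.1 (Finset.mem_coe.1 ha)
    exact b.2
  · refine le_trans ?_ hv.le
    calc _ ≤ μH[n] (((A \ ⋃ m : ℕ, densePoints f A θ (1 / (m + 1))) \ ⋃ a ∈ u, a.2.2.1) ∪
          ⋃ a : {a : u // a ∉ v}, a.1.1.2.2.1) := by
          refine measure_mono fun x hx => ?_
          by_cases hxu : x ∈ ⋃ a ∈ u, a.2.2.1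
          · right
            obtain ⟨a, ha, hxa⟩ := mem_iUnion₂.1 hxu
            refine mem_iUnion.2 ⟨⟨⟨a, ha⟩, fun hav => hx.2 ?_⟩, hxa⟩
            exact mem_iUnion₂.2 ⟨a, Finset.mem_map.2 ⟨⟨a, ha⟩, hav, rfl⟩, hxa⟩
          · exact Or.inl ⟨hx.1, hxu⟩
      _ ≤ 0 + ∑' a : {a : u // a ∉ v}, μH[n] a.1.1.2.2.1 :=
          (measure_union_le _ _).trans (add_le_add hu0.le (measure_iUnion_le _))
      _ = _ := zero_add _

/-- A Lipschitz map that is nowhere bi-Lipschitz can be perturbed so that the image has small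
volume. -/
theorem exists_perturbation (hfin : μH[n] (univ : Set X) < ∞)
    (hld : ∀ᵐ x ∂(μH[n] : Measure X),
      0 < liminf (fun r : ℝ => μH[n] (closedBall x r) / ENNReal.ofReal (r ^ n)) (𝓝[>] 0))
    {K : Set X} (hK : IsCompact K) (hf : LipschitzWith L f) (hL : 1 ≤ L)
    (hnull : ∀ E ⊆ K, IsClosed E →
      (∃ c > 0, ∀ x ∈ E, ∀ y ∈ E, c * dist x y ≤ ‖f x - f y‖) → μH[n] E = 0)
    {η : ℝ} (hη : 0 < η) :
    ∃ g, Continuous g ∧ (∀ x, ‖g x - f x‖ ≤ η) ∧ volume (g '' K) ≤ ENNReal.ofReal η := by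
  have : IsFiniteMeasure (μH[n] : Measure X) := ⟨hfin⟩
  set C : ℝ≥0 := 34 * L + 1 with hC
  have hC0 : 0 < C := by positivity
  have hLC : L ≤ C := by
    rw [hC]
    exact (le_mul_of_one_le_left zero_le (by norm_num)).trans (le_add_of_nonneg_right zero_le)
  set δ : ℝ := η / (4 * (C : ℝ) ^ n) with hδ
  have hδ0 : 0 < δ := by positivity
  set s : ℝ := δ / ((μH[n] (univ : Set X)).toReal + 1) with hs
  have hs0 : 0 < s := by positivity
  have hδ' : 0 < ENNReal.ofReal δ := ENNReal.ofReal_pos.2 hδ0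
  obtain ⟨A, hAK, hA, hKA, k, hk, hAk⟩ := exists_isCompact_regular hfin hld hK hδ'
  obtain ⟨N, hN, hNs⟩ : ∃ N : ℕ, 0 < N ∧ k ^ 2 * (4 * N * L) ^ n < (1 + s) ^ N := by
    have h := (tendsto_pow_const_div_const_pow_of_one_lt n
      (by linarith : 1 < 1 + s)).const_mul (k ^ 2 * (4 * L) ^ n)
    rw [mul_zero] at h
    obtain ⟨N, hN1, hN2⟩ := ((h.eventually_lt_const one_pos).and (eventually_gt_atTop 0)).exists
    refine ⟨N, hN2, ?_⟩
    rw [← mul_div_assoc, div_lt_one (by positivity)] at hN1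
    calc k ^ 2 * (4 * N * L) ^ n = k ^ 2 * (4 * L) ^ n * N ^ n := by
          rw [mul_assoc (k ^ 2), ← mul_pow]
          ring_nf
      _ < _ := hN1
  obtain ⟨U, hAU, hU, -, hUA⟩ :=
    hA.isClosed.measurableSet.exists_isOpen_sdiff_lt (measure_ne_top μH[n] A) hδ'.ne'
  set θ : ℝ := 1 / (4 * N) with hθ
  have hN' : (1 : ℝ) ≤ N := by exact_mod_cast hN
  have hθ0 : 0 < θ := by positivity
  have hθ1 : θ ≤ 1 := by
    rw [hθ, div_le_one (by positivity)]
    linarith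
  obtain ⟨v, hv, hvd, hvδ⟩ :=
    exists_finset_isCollapse hfin hk hAk hf hL hs0 hN hNs hθ hU hAU hη hδ'
  obtain ⟨g, hg, hgη, hgf, hgv⟩ := exists_forall_eq_of_isCollapse hf.continuous hη
    hA.isClosed.measurableSet (fun a ha => (hv a ha).2) hvd
  refine ⟨g, hg, hgη, ?_⟩
  set W : Set X := ⋃ a ∈ v, a.2.2.1
  set D : Set X := ⋃ m : ℕ, densePoints f A θ (1 / (m + 1))
  have hD : volume (f '' D) = 0 := by
    rw [image_iUnion, measure_iUnion_null_iff]
    intro m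
    exact volume_image_densePoints_eq_zero hfin hk hA.isClosed hAk hf hL hθ0 hθ1 (by positivity)
      fun E hE => hnull E (hE.trans hAK)
  have hLip : ∀ S : Set X, μH[n] S ≤ ENNReal.ofReal δ →
      volume (f '' S) ≤ (C : ℝ≥0∞) ^ n * ENNReal.ofReal δ := fun S hS =>
    (volume_image_le hf S).trans (mul_le_mul' (pow_le_pow_left' (by exact_mod_cast hLC) n) hS)
  have hsub : g '' K ⊆ f '' D ∪ f '' ((A \ D) \ W) ∪ f '' (K \ A) ∪ g '' W := by
    rintro _ ⟨y, hy, rfl⟩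
    by_cases hyW : y ∈ W
    · exact Or.inr ⟨y, hyW, rfl⟩
    · left
      rw [hgf y hyW]
      by_cases hyA : y ∈ A
      · left
        by_cases hyD : y ∈ D
        · exact Or.inl ⟨y, hyD, rfl⟩
        · exact Or.inr ⟨y, ⟨⟨hyA, hyD⟩, hyW⟩, rfl⟩
      · exact Or.inr ⟨y, ⟨hy, hyA⟩, rfl⟩
  have hW : volume (g '' W) ≤ (C : ℝ≥0∞) ^ n * (ENNReal.ofReal δ + ENNReal.ofReal δ) := by
    refine hgv.trans (mul_le_mul_right (add_le_add ?_ ?_) _)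
    · calc ENNReal.ofReal s * μH[n] W ≤ ENNReal.ofReal s * μH[n] (univ : Set X) := by
            gcongr
            exact subset_univ _
        _ = ENNReal.ofReal (s * (μH[n] (univ : Set X)).toReal) := by
            rw [ENNReal.ofReal_mul hs0.le, ENNReal.ofReal_toReal hfin.ne]
        _ ≤ ENNReal.ofReal δ := by
            refine ENNReal.ofReal_le_ofReal ?_
            rw [hs, div_mul_eq_mul_div, div_le_iff₀ (by positivity)]
            nlinarith
    · exact (measure_mono (sdiff_subset_sdiff_left (iUnion₂_subset fun a ha => (hv a ha).1))).trans
        hUA.le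
  calc volume (g '' K) ≤ volume (f '' D ∪ f '' ((A \ D) \ W) ∪ f '' (K \ A) ∪ g '' W) :=
        measure_mono hsub
    _ ≤ 0 + (C : ℝ≥0∞) ^ n * ENNReal.ofReal δ + (C : ℝ≥0∞) ^ n * ENNReal.ofReal δ +
        (C : ℝ≥0∞) ^ n * (ENNReal.ofReal δ + ENNReal.ofReal δ) := by
        refine (measure_union_le _ _).trans (add_le_add ?_ hW)
        refine (measure_union_le _ _).trans (add_le_add ?_ (hLip _ hKA.le))
        exact (measure_union_le _ _).trans (add_le_add hD.le (hLip _ hvδ))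
    _ = ENNReal.ofReal (4 * (C : ℝ) ^ n * δ) := by
        rw [ENNReal.ofReal_mul (by positivity), ENNReal.ofReal_mul (by norm_num),
          ENNReal.ofReal_pow C.coe_nonneg, ENNReal.ofReal_coe_nnreal, ENNReal.ofReal_ofNat]
        ring
    _ = ENNReal.ofReal η := by
        rw [hδ, mul_div_cancel₀ _ (by positivity)]

end Perturbation

section Charts

variable {X : Type*} {n : ℕ}

/-- A compact set on which a continuous map to `ℝ^n` does not shrink distances by more than a
constant factor is rectifiable. -/
theorem isRectifiableSet_of_le_norm_sub [Nonempty X] [MetricSpace X] [MeasurableSpace X]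
    [BorelSpace X] {E : Set X} (hE : IsCompact E) {f : X → Fin n → ℝ} (hf : Continuous f) {c : ℝ}
    (hc : 0 < c) (h : ∀ x ∈ E, ∀ y ∈ E, c * dist x y ≤ ‖f x - f y‖) : IsRectifiableSet n E := by
  set φ : X → EuclideanSpace ℝ (Fin n) := fun x => WithLp.toLp 2 (f x)
  have hφ : Continuous φ := (PiLp.continuous_toLp 2 _).comp hf
  have hφE : ∀ x ∈ E, ∀ y ∈ E, c * dist x y ≤ dist (φ x) (φ y) := fun x hx y hy => by
    have h1 := (PiLp.lipschitzWith_ofLp 2 (fun _ : Fin n => ℝ)).dist_le_mul (φ x) (φ y)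
    rw [NNReal.coe_one, one_mul] at h1
    exact (h x hx y hy).trans ((dist_eq_norm (f x) (f y)).symm.le.trans h1)
  have hinj : InjOn φ E := fun x hx y hy hxy => by
    have h1 := hφE x hx y hy
    rw [hxy, dist_self] at h1
    exact dist_le_zero.1 (nonpos_of_mul_nonpos_right h1 hc)
  refine ⟨hE.isClosed.measurableSet, fun _ => φ '' E, fun _ => Function.invFunOn φ E,
    fun _ => (hE.image hφ).isClosed.measurableSet, fun _ => ⟨(1 / c).toNNReal, ?_⟩, ?_⟩
  · refine LipschitzOnWith.of_dist_le_mul fun p hp q hq => ?_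
    rw [Real.coe_toNNReal _ (by positivity), div_mul_eq_mul_div, one_mul, le_div_iff₀ hc, mul_comm]
    have h1 := hφE _ (Function.invFunOn_mem hp) _ (Function.invFunOn_mem hq)
    rwa [Function.invFunOn_eq hp, Function.invFunOn_eq hq] at h1
  · have : E \ ⋃ _ : ℕ, Function.invFunOn φ E '' (φ '' E) = ∅ := by
      rw [iUnion_const, sdiff_eq_empty, hinj.invFunOn_image Subset.rfl]
    rw [this, measure_empty]

/-- Every nonempty open subset of a topological manifold contains an embedded closed cube. -/
theorem exists_continuous_injective_closedBall [TopologicalSpace X]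
    (hman : ∀ x : X, ∃ U : Set X, IsOpen U ∧ x ∈ U ∧
      ∃ V : Set (EuclideanSpace ℝ (Fin n)), IsOpen V ∧ Nonempty (U ≃ₜ V))
    {O : Set X} (hO : IsOpen O) (hne : O.Nonempty) :
    ∃ ψ : closedBall (0 : Fin n → ℝ) 1 → X,
      Continuous ψ ∧ Function.Injective ψ ∧ range ψ ⊆ O := by
  obtain ⟨x, hx⟩ := hne
  obtain ⟨U, -, hxU, V, hV, ⟨e⟩⟩ := hman x
  have hs : IsOpen (Subtype.val '' {v : V | (e.symm v : X) ∈ O}) :=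
    hV.isOpenMap_subtype_val _ (hO.preimage (continuous_subtype_val.comp e.symm.continuous))
  set p : Fin n → ℝ := WithLp.ofLp (e ⟨x, hxU⟩ : EuclideanSpace ℝ (Fin n))
  have hp : p ∈ WithLp.toLp 2 ⁻¹' (Subtype.val '' {v : V | (e.symm v : X) ∈ O}) :=
    ⟨e ⟨x, hxU⟩, by simpa using hx, rfl⟩
  obtain ⟨δ, hδ, hδs⟩ := nhds_basis_closedBall.mem_iff.1
    ((hs.preimage (PiLp.continuous_toLp 2 _)).mem_nhds hp)
  have hmem : ∀ z : closedBall (0 : Fin n → ℝ) 1, ∃ h : WithLp.toLp 2 (p + δ • (z : Fin n → ℝ)) ∈ V,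
      (e.symm ⟨_, h⟩ : X) ∈ O := by
    intro z
    have hz : p + δ • (z : Fin n → ℝ) ∈ closedBall p δ := by
      rw [mem_closedBall, dist_eq_norm, add_sub_cancel_left, norm_smul, Real.norm_of_nonneg hδ.le]
      exact mul_le_of_le_one_right hδ.le (mem_closedBall_zero_iff.1 z.2)
    obtain ⟨v, hv, hvz⟩ := hδs hz
    rw [← hvz]
    exact ⟨v.2, hv⟩
  refine ⟨fun z => e.symm ⟨_, (hmem z).1⟩, ?_, ?_, ?_⟩
  · refine continuous_subtype_val.comp (e.symm.continuous.comp (Continuous.subtype_mk ?_ _))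
    exact (PiLp.continuous_toLp 2 _).comp
      (continuous_const.add (continuous_subtype_val.const_smul δ))
  · intro z z' hzz
    have h1 := e.symm.injective (Subtype.val_injective hzz)
    have h2 := WithLp.toLp_injective 2 (congrArg Subtype.val h1)
    exact Subtype.val_injective (smul_right_injective _ hδ.ne' (add_left_cancel h2))
  · rintro _ ⟨z, rfl⟩
    exact (hmem z).2

end Charts

end MetricManifold

/-- If `X` is a compact topological `n`-manifold with a metric inducing its topology,
`H^n(X) < ∞`, and positive lower `n`-density `H^n`-a.e., then every nonempty open subset of
`X` contains an `n`-rectifiable subset of positive `H^n`-measure. -/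
theorem stmt10 {X : Type*} [MetricSpace X] [MeasurableSpace X] [BorelSpace X]
    [CompactSpace X] (n : ℕ)
    (hman : ∀ x : X, ∃ U : Set X, IsOpen U ∧ x ∈ U ∧
      ∃ V : Set (EuclideanSpace ℝ (Fin n)), IsOpen V ∧ Nonempty (U ≃ₜ V))
    (hfin : μH[n] (univ : Set X) < ∞)
    (hld : ∀ᵐ x ∂(μH[n] : Measure X),
      0 < liminf (fun r : ℝ => μH[n] (closedBall x r) / ENNReal.ofReal (r ^ n)) (𝓝[>] 0)) :
    ∀ O : Set X, IsOpen O → O.Nonempty →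
      ∃ E : Set X, E ⊆ O ∧ IsRectifiableSet n E ∧ 0 < μH[n] E := by
  intro O hO hne
  by_contra! hcon
  have : Nonempty X := hne.to_type
  obtain ⟨ψ, hψ, hinj, hψO⟩ := MetricManifold.exists_continuous_injective_closedBall hman hO hne
  obtain ⟨C, f, hf, hfψ⟩ := MetricManifold.exists_lipschitz_approx hψ hinj
    (continuous_subtype_val : Continuous (Subtype.val : closedBall (0 : Fin n → ℝ) 1 → _))
    (by norm_num : (0 : ℝ) < 1 / 8)
  have hK : IsCompact (range ψ) := isCompact_range hψ
  set η : ℝ := min (1 / 8) ((1 / 2) ^ n / 2)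
  have hη : 0 < η := by positivity
  obtain ⟨g, hg, hgf, hgK⟩ := MetricManifold.exists_perturbation hfin hld hK
    (hf.weaken (le_max_left C 1)) (le_max_right C 1)
    (fun E hEK hE ⟨c, hc, hcE⟩ => nonpos_iff_eq_zero.1 (hcon E (hEK.trans hψO)
      (MetricManifold.isRectifiableSet_of_le_norm_sub hE.isCompact hf.continuous hc hcE))) hη
  have hball : ball (0 : Fin n → ℝ) (1 / 4) ⊆ range (g ∘ ψ) := by
    refine MetricManifold.ball_subset_range_of_norm_sub_le (hg.comp hψ) fun z => ?_
    calc ‖g (ψ z) - z‖ ≤ ‖g (ψ z) - f (ψ z)‖ + ‖f (ψ z) - z‖ := norm_sub_le_norm_sub_add_norm_sub ..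
      _ ≤ 1 / 8 + 1 / 8 := add_le_add ((hgf _).trans (min_le_left _ _)) (hfψ z)
      _ = 1 / 4 := by norm_num
  rw [range_comp] at hball
  have h := (measure_mono hball).trans hgK
  rw [Real.volume_pi_ball _ (by norm_num), Fintype.card_fin, ENNReal.ofReal_le_ofReal_iff hη.le]
    at h
  have h2 : (0 : ℝ) < (1 / 2) ^ n := by positivity
  have h3 : η ≤ (1 / 2) ^ n / 2 := min_le_right _ _
  norm_num at h h2 h3
  linarith
end
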